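/- arXiv:1101.4278 — 5 statements merged into one kernel-verified Lean document; each statement's English description precedes it below -/
import Mathlib

section
/- For every integer l ≥ 1, ε_l = ∑_{j=1}^{l} ∑_{i_1+⋯+i_j=l, i_1,…,i_j ≥ 1} (-1)^{j+l} · (i_1!)²⋯(i_j!)² / ((2i_1+1)!⋯(2i_j+1)!), where the inner sum ranges over all ordered j-tuples (compositions) of positive integers summing to l. -/
open Finset

/-- The defining property of the sequence `ε` of Tsukuda/Tsutaya: `ε 0 = 1` and for each
`l ≥ 1`, `1/(2l+1)! = ∑_{i=1}^{l} ∑_{j₁+⋯+jᵢ=l, jₜ ≥ 1} 2^i εᵢ / ((2j₁)!⋯(2jᵢ)!)`,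
the inner sum ranging over ordered `i`-tuples of positive integers summing to `l`. -/
def IsEpsilon (ε : ℕ → ℚ) : Prop :=
  ε 0 = 1 ∧ ∀ l : ℕ, 1 ≤ l →
    (1 : ℚ) / ((2 * l + 1).factorial : ℚ) =
      ∑ i ∈ Finset.Icc 1 l,
        ∑ c ∈ (Fintype.piFinset fun _ : Fin i => Finset.Icc 1 l).filter
            (fun c => ∑ t, c t = l),
          2 ^ i * ε i / ∏ t, ((2 * c t).factorial : ℚ)

open PowerSeries in
/-- The coefficients of the powers of a power series without constant term are sums over
compositions. -/
theorem coeff_pow_eq_sum_compositions {R : Type*} [CommSemiring R] {f : R⟦X⟧}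
    (hf : constantCoeff f = 0) (l i : ℕ) :
    coeff l (f ^ i) =
      ∑ c ∈ (Fintype.piFinset fun _ : Fin i => Finset.Icc 1 l).filter (fun c => ∑ t, c t = l),
        ∏ t, coeff (c t) f := by
  have hprod : f ^ i = ∏ _t : Fin i, f := by simp
  rw [hprod, coeff_prod]
  symm
  refine Finset.sum_of_injOn (fun c => Finsupp.equivFunOnFinite.symm c)
    (Finsupp.equivFunOnFinite.symm.injective.injOn) ?_ ?_ ?_
  · intro c hc
    simp only [Finset.coe_filter, Set.mem_ofPred_eq] at hc
    simpa using hc.2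
  · intro c hc hc'
    by_contra hne
    refine hc' ⟨c, ?_, by simp⟩
    have hsum : ∑ t, c t = l := (mem_finsuppAntidiag.1 hc).1
    simp only [Finset.coe_filter, Set.mem_ofPred_eq, Fintype.mem_piFinset, Finset.mem_Icc]
    refine ⟨fun t => ⟨?_, ?_⟩, hsum⟩
    · rw [Nat.one_le_iff_ne_zero]
      intro h0
      exact hne (Finset.prod_eq_zero (Finset.mem_univ t) (by simpa [h0] using hf))
    · exact hsum ▸ Finset.single_le_sum (f := fun t => c t) (fun _ _ => Nat.zero_le _)
        (Finset.mem_univ t)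
  · intro c _
    simp

open PowerSeries in
theorem coeff_pow_eq_zero_of_lt {R : Type*} [CommSemiring R] {f : R⟦X⟧}
    (hf : constantCoeff f = 0) {l i : ℕ} (h : l < i) : coeff l (f ^ i) = 0 :=
  X_pow_dvd_iff.1 (pow_dvd_pow_of_dvd (X_dvd_iff.2 hf) i) l h

open PowerSeries in
theorem coeff_subst_eq_sum_Icc {R : Type*} [CommRing R] {f g : R⟦X⟧}
    (hg : constantCoeff g = 0) {l : ℕ} (hl : 1 ≤ l) :
    coeff l (f.subst g) = ∑ i ∈ Finset.Icc 1 l, coeff i f * coeff l (g ^ i) := by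
  rw [coeff_subst' (HasSubst.of_constantCoeff_zero' hg)]
  simp only [smul_eq_mul]
  refine finsum_eq_sum_of_support_subset _ fun i hi => ?_
  rw [Finset.coe_Icc, Set.mem_Icc]
  by_contra h
  apply hi
  rcases Nat.eq_zero_or_pos i with rfl | hi0
  · simp [coeff_one, Nat.one_le_iff_ne_zero.1 hl]
  · dsimp only
    rw [coeff_pow_eq_zero_of_lt hg (by omega), mul_zero]

open PowerSeries in
/-- Substitution of a power series `X + O(X ^ 2)` is injective. -/
theorem subst_injective_of_coeff_one {R : Type*} [CommRing R] {g : R⟦X⟧}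
    (hg : constantCoeff g = 0) (hg1 : coeff 1 g = 1) :
    Function.Injective fun f : R⟦X⟧ => f.subst g := by
  have hu : IsUnit (coeff 1 g) := hg1 ▸ isUnit_one
  intro f₁ f₂ h
  have hcomp (f : R⟦X⟧) : PowerSeries.subst (g.substInvOfIsUnit hu) (f.subst g : R⟦X⟧) = f := by
    rw [subst_comp_subst_apply (HasSubst.of_constantCoeff_zero' hg) (HasSubst.substInvOfIsUnit ..),
      subst_substInvOfIsUnit_right g hg hu, X_subst]
  rw [← hcomp f₁, ← hcomp f₂]
  exact congrArg (fun f : R⟦X⟧ => f.subst (g.substInvOfIsUnit hu)) h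

namespace EpsilonSeries

open PowerSeries

/-- The series `cosh √X`. -/
noncomputable def coshSqrt : ℚ⟦X⟧ := PowerSeries.mk fun n => 1 / ((2 * n).factorial : ℚ)

/-- The series `sinh √X / √X`. -/
noncomputable def sinhSqrt : ℚ⟦X⟧ := PowerSeries.mk fun n => 1 / ((2 * n + 1).factorial : ℚ)

/-- The series `arsinh (√X / 2) / ((√X / 2) * √(1 + X / 4))`. -/
noncomputable def arsinhSqrt : ℚ⟦X⟧ :=
  PowerSeries.mk fun n => (-1) ^ n * ((n.factorial : ℚ) ^ 2 / ((2 * n + 1).factorial : ℚ))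

theorem derivative_coshSqrt : 2 * d⁄dX ℚ coshSqrt = sinhSqrt := by
  ext n
  rw [two_mul, map_add, coeff_derivative, coshSqrt, sinhSqrt, coeff_mk, coeff_mk,
    show 2 * (n + 1) = (2 * n + 1) + 1 by ring, Nat.factorial_succ (2 * n + 1)]
  push_cast
  field_simp
  ring

theorem derivative_sinhSqrt : 2 * X * d⁄dX ℚ sinhSqrt + sinhSqrt = coshSqrt := by
  rw [show (2 * X * d⁄dX ℚ sinhSqrt : ℚ⟦X⟧) = C 2 * (X * d⁄dX ℚ sinhSqrt) by
    rw [map_ofNat]; ring]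
  ext n
  rw [map_add, coeff_C_mul, coshSqrt, sinhSqrt]
  cases n with
  | zero => simp
  | succ n =>
    rw [coeff_succ_X_mul, coeff_derivative, coeff_mk, coeff_mk, Nat.factorial_succ (2 * (n + 1))]
    push_cast
    field_simp

theorem coshSqrt_sq : coshSqrt ^ 2 - X * sinhSqrt ^ 2 = 1 := by
  refine derivative.ext ?_ (by simp [coshSqrt])
  have h1 := derivative_coshSqrt
  have h2 := derivative_sinhSqrt
  simp only [map_sub, derivative_pow, Derivation.leibniz, derivative_X, smul_eq_mul,
    derivative_one]
  simp only [Nat.cast_ofNat, Nat.add_one_sub_one, pow_one]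
  linear_combination coshSqrt * h1 - sinhSqrt * h2

theorem derivative_arsinhSqrt :
    X * (4 + X) * d⁄dX ℚ arsinhSqrt + (2 + X) * arsinhSqrt = 2 := by
  rw [show (X * (4 + X) * d⁄dX ℚ arsinhSqrt + (2 + X) * arsinhSqrt : ℚ⟦X⟧) =
      C 2 * arsinhSqrt + X * (C 4 * d⁄dX ℚ arsinhSqrt + X * d⁄dX ℚ arsinhSqrt + arsinhSqrt) by
    rw [map_ofNat, map_ofNat]; ring, show (2 : ℚ⟦X⟧) = C 2 by rw [map_ofNat]]
  ext n
  rcases n with _ | n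
  · simp [arsinhSqrt]
  · have hX : coeff n (X * d⁄dX ℚ arsinhSqrt) = n * coeff n arsinhSqrt := by
      rcases n with _ | n
      · simp
      · rw [coeff_succ_X_mul, coeff_derivative]
        push_cast
        ring
    rw [map_add, coeff_C_mul, coeff_succ_X_mul, map_add, map_add, hX, coeff_C_mul,
      coeff_derivative, coeff_C, if_neg (Nat.succ_ne_zero n), arsinhSqrt, coeff_mk, coeff_mk,
      show 2 * (n + 1) + 1 = (2 * n + 1) + 1 + 1 by ring, Nat.factorial_succ (2 * n + 1 + 1),
      Nat.factorial_succ (2 * n + 1), Nat.factorial_succ n, pow_succ]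
    push_cast
    field_simp
    ring

/-- The series `2 * (cosh √X - 1)`. -/
noncomputable def twoCoshSubOne : ℚ⟦X⟧ := 2 * (coshSqrt - 1)

theorem coeff_twoCoshSubOne {n : ℕ} (hn : 1 ≤ n) :
    coeff n twoCoshSubOne = 2 / ((2 * n).factorial : ℚ) := by
  rw [twoCoshSubOne, show (2 : ℚ⟦X⟧) = C 2 by rw [map_ofNat], coeff_C_mul, map_sub, coeff_one,
    if_neg (by omega), coshSqrt, coeff_mk]
  ring

theorem constantCoeff_twoCoshSubOne : constantCoeff twoCoshSubOne = 0 := by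
  simp [twoCoshSubOne, coshSqrt]

theorem coeff_one_twoCoshSubOne : coeff 1 twoCoshSubOne = 1 := by
  simp [coeff_twoCoshSubOne]

theorem hasSubst_twoCoshSubOne : HasSubst twoCoshSubOne :=
  HasSubst.of_constantCoeff_zero' constantCoeff_twoCoshSubOne

theorem sinhSqrt_mul_arsinhSqrt_subst : sinhSqrt * arsinhSqrt.subst twoCoshSubOne = 1 := by
  have hV := hasSubst_twoCoshSubOne
  have hd := derivative_subst (f := arsinhSqrt) hV
  have hdV : d⁄dX ℚ twoCoshSubOne = sinhSqrt := by
    have h2 : d⁄dX ℚ (2 : ℚ⟦X⟧) = 0 := by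
      rw [show (2 : ℚ⟦X⟧) = C 2 by rw [map_ofNat], derivative_C]
    simp only [twoCoshSubOne, Derivation.leibniz, h2, map_sub, derivative_one, smul_eq_mul]
    linear_combination derivative_coshSqrt
  have hode := congrArg (substAlgHom hV : ℚ⟦X⟧ →ₐ[ℚ] ℚ⟦X⟧) derivative_arsinhSqrt
  simp only [map_add, map_mul, map_ofNat, substAlgHom_X, coe_substAlgHom] at hode
  rw [hdV] at hd
  set G : ℚ⟦X⟧ := arsinhSqrt.subst twoCoshSubOne with hG
  have hsq := coshSqrt_sq
  have hs := derivative_sinhSqrt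
  have hH : 2 * (X * d⁄dX ℚ (sinhSqrt * G)) + sinhSqrt * G = 1 := by
    have h2 : (2 : ℚ⟦X⟧) ≠ 0 := fun h => by
      have h' := congrArg constantCoeff h
      rw [map_ofNat, map_zero] at h'
      exact two_ne_zero h'
    apply mul_left_cancel₀ h2
    simp only [Derivation.leibniz, smul_eq_mul]
    rw [hd]
    set D : ℚ⟦X⟧ := (d⁄dX ℚ arsinhSqrt).subst twoCoshSubOne
    have hVC : twoCoshSubOne = 2 * (coshSqrt - 1) := rfl
    linear_combination hode - 4 * hsq * D + 2 * G * hs -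
      ((4 + twoCoshSubOne + 2 * (coshSqrt - 1)) * D + G) * hVC
  rw [show (2 : ℚ⟦X⟧) = C 2 by rw [map_ofNat]] at hH
  ext n
  have hn := congrArg (coeff n) hH
  rw [map_add, coeff_C_mul] at hn
  rcases n with _ | n
  · simpa using hn
  · rw [coeff_succ_X_mul, coeff_derivative, coeff_one, if_neg (Nat.succ_ne_zero n)] at hn
    rw [coeff_one, if_neg (Nat.succ_ne_zero n)]
    have hn' : (2 * (n + 1) + 1 : ℚ) * coeff (n + 1) (sinhSqrt * G) = 0 := by
      linear_combination hn
    exact (mul_eq_zero.1 hn').resolve_left (by positivity)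

theorem subst_twoCoshSubOne_of_isEpsilon {ε : ℕ → ℚ} (hε : IsEpsilon ε) :
    (PowerSeries.mk ε).subst twoCoshSubOne = sinhSqrt := by
  have hV0 := constantCoeff_twoCoshSubOne
  ext l
  rcases Nat.eq_zero_or_pos l with rfl | hl
  · rw [coeff_subst' hasSubst_twoCoshSubOne, finsum_eq_single _ 0]
    · simp [hε.1, sinhSqrt]
    · intro i hi
      rw [coeff_pow_eq_zero_of_lt hV0 (Nat.pos_of_ne_zero hi), smul_zero]
  · rw [coeff_subst_eq_sum_Icc hV0 hl, sinhSqrt, coeff_mk, hε.2 l hl]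
    refine Finset.sum_congr rfl fun i _ => ?_
    rw [coeff_pow_eq_sum_compositions hV0, coeff_mk, Finset.mul_sum]
    refine Finset.sum_congr rfl fun c hc => ?_
    have hc1 : ∀ t, 1 ≤ c t := fun t =>
      (Finset.mem_Icc.1 (Fintype.mem_piFinset.1 (Finset.mem_filter.1 hc).1 t)).1
    rw [Finset.prod_congr rfl fun t _ => coeff_twoCoshSubOne (hc1 t), Finset.prod_div_distrib]
    simp
    ring

theorem mk_mul_arsinhSqrt {ε : ℕ → ℚ} (hε : IsEpsilon ε) :
    PowerSeries.mk ε * arsinhSqrt = 1 := by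
  refine subst_injective_of_coeff_one constantCoeff_twoCoshSubOne coeff_one_twoCoshSubOne ?_
  have hV := hasSubst_twoCoshSubOne
  dsimp only
  rw [subst_mul hV, subst_twoCoshSubOne_of_isEpsilon hε, sinhSqrt_mul_arsinhSqrt_subst,
    ← coe_substAlgHom hV, map_one]

end EpsilonSeries

open PowerSeries in
/-- The coefficients of an inverse power series, by the geometric series. -/
theorem coeff_eq_sum_coeff_pow_of_mul_eq_one {R : Type*} [CommRing R] {f g : R⟦X⟧}
    (hg : constantCoeff g = 1) (hfg : f * g = 1) {l : ℕ} (hl : 1 ≤ l) :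
    coeff l f = ∑ j ∈ Finset.Icc 1 l, coeff l ((1 - g) ^ j) := by
  have h0 : constantCoeff (1 - g) = 0 := by simp [hg]
  have hgeom := mul_neg_geom_sum (1 - g) (l + 1)
  have hsum : ∑ j ∈ Finset.range (l + 1), (1 - g) ^ j = f - f * (1 - g) ^ (l + 1) := by
    linear_combination f * hgeom - hfg * ∑ j ∈ Finset.range (l + 1), (1 - g) ^ j
  have hzero : coeff l (f * (1 - g) ^ (l + 1)) = 0 :=
    X_pow_dvd_iff.1 (Dvd.dvd.mul_left (pow_dvd_pow_of_dvd (X_dvd_iff.2 h0) _) f) l l.lt_succ_self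
  have hcoeff := congrArg (coeff l) hsum
  rw [map_sub, hzero, sub_zero, map_sum, Finset.sum_range_succ', pow_zero, coeff_one,
    if_neg (by omega), add_zero] at hcoeff
  rw [← hcoeff, Finset.range_eq_Ico, Finset.sum_Ico_add' (fun j => coeff l ((1 - g) ^ j)) 0 l 1]
  rfl

theorem epsilon_formula (ε : ℕ → ℚ) (hε : IsEpsilon ε) (l : ℕ) (hl : 1 ≤ l) :
    ε l =
      ∑ j ∈ Finset.Icc 1 l,
        ∑ c ∈ (Fintype.piFinset fun _ : Fin j => Finset.Icc 1 l).filter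
            (fun c => ∑ t, c t = l),
          (-1 : ℚ) ^ (j + l) *
            ∏ t, ((c t).factorial : ℚ) ^ 2 / ((2 * c t + 1).factorial : ℚ) := by
  have h0 : PowerSeries.constantCoeff EpsilonSeries.arsinhSqrt = 1 := by
    simp [EpsilonSeries.arsinhSqrt]
  have h1 : PowerSeries.constantCoeff (1 - EpsilonSeries.arsinhSqrt) = 0 := by simp [h0]
  rw [← PowerSeries.coeff_mk l ε,
    coeff_eq_sum_coeff_pow_of_mul_eq_one h0 (EpsilonSeries.mk_mul_arsinhSqrt hε) hl]
  refine Finset.sum_congr rfl fun j _ => ?_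
  rw [coeff_pow_eq_sum_compositions h1]
  refine Finset.sum_congr rfl fun c hc => ?_
  obtain ⟨hc, hsum⟩ := Finset.mem_filter.1 hc
  have hcoeff : ∀ t, PowerSeries.coeff (c t) (1 - EpsilonSeries.arsinhSqrt) =
      (-1) ^ (1 + c t) * (((c t).factorial : ℚ) ^ 2 / ((2 * c t + 1).factorial : ℚ)) := by
    intro t
    have ht := (Finset.mem_Icc.1 (Fintype.mem_piFinset.1 hc t)).1
    rw [map_sub, PowerSeries.coeff_one, if_neg (by omega), EpsilonSeries.arsinhSqrt,
      PowerSeries.coeff_mk]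
    ring
  rw [Finset.prod_congr rfl fun t _ => hcoeff t, Finset.prod_mul_distrib,
    Finset.prod_pow_eq_pow_sum, Finset.sum_add_distrib, hsum]
  simp
end

section
/- For every integer l ≥ 1, ε_l − 6^{−l} lies in 2^{−l+1}·ℤ_(2); equivalently, v_2(ε_l − 6^{−l}) ≥ −l + 1 whenever ε_l ≠ 6^{−l}. -/
open Finset

namespace EpsilonSequence

open PowerSeries

/-- The power series `∑ uⁿ / (2n+1)!`, that is, `sinh x / x` in the variable `u = x²`. -/
noncomputable def sinhSeries : ℚ⟦X⟧ := mk fun n => 1 / ((2 * n + 1).factorial : ℚ)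

/-- The power series `∑_{n ≥ 1} uⁿ / (2n)!`, that is, `cosh x - 1` in the variable `u = x²`. -/
noncomputable def coshSubOneSeries : ℚ⟦X⟧ :=
  mk fun n => if n = 0 then 0 else 1 / ((2 * n).factorial : ℚ)

/-- The coefficients of `x / sinh x` as a power series in `cosh x - 1`. -/
def invSinhCoeff : ℕ → ℚ
  | 0 => 1
  | n + 1 => -((n + 1 : ℕ) / (2 * n + 3 : ℕ)) * invSinhCoeff n

/-- The power series `H` such that `x / sinh x = H (cosh x - 1)`. -/
noncomputable def invSinhSeries : ℚ⟦X⟧ := mk invSinhCoeff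

theorem coeff_coshSubOneSeries_pow (i l : ℕ) :
    coeff l (coshSubOneSeries ^ i) =
      ∑ c ∈ (Fintype.piFinset fun _ : Fin i => Finset.Icc 1 l).filter (fun c => ∑ t, c t = l),
        1 / ∏ t, ((2 * c t).factorial : ℚ) := by
  classical
  have hpow : coshSubOneSeries ^ i = ∏ _t : Fin i, coshSubOneSeries := by simp
  rw [hpow, coeff_prod]
  symm
  refine Finset.sum_of_injOn (fun c => Finsupp.equivFunOnFinite.symm c)
    Finsupp.equivFunOnFinite.symm.injective.injOn ?_ ?_ ?_
  · intro c hc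
    simp only [coe_filter, Set.mem_ofPred_eq] at hc
    simp [mem_finsuppAntidiag, hc.2]
  · intro f hf hf'
    by_contra hne
    refine hf' ⟨f, ?_, by ext; simp⟩
    have hsum : ∑ t, f t = l := (mem_finsuppAntidiag.mp hf).1
    simp only [coe_filter, Set.mem_ofPred_eq, Fintype.mem_piFinset, mem_Icc]
    refine ⟨fun t => ⟨?_, ?_⟩, hsum⟩
    · refine Nat.one_le_iff_ne_zero.mpr fun h0 => hne ?_
      exact Finset.prod_eq_zero (mem_univ t) (by simp [coshSubOneSeries, h0])
    · rw [← hsum]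
      exact Finset.single_le_sum (f := fun t => f t) (fun _ _ => Nat.zero_le _) (mem_univ t)
  · intro c hc
    simp only [mem_filter, Fintype.mem_piFinset, mem_Icc] at hc
    rw [one_div, ← Finset.prod_inv_distrib]
    refine Finset.prod_congr rfl fun t _ => ?_
    have : c t ≠ 0 := by have := (hc.1 t).1; omega
    simp [coshSubOneSeries, this]

theorem hasSubst_coshSubOneSeries : HasSubst coshSubOneSeries :=
  HasSubst.of_constantCoeff_zero' (by simp [coshSubOneSeries, ← coeff_zero_eq_constantCoeff_apply])

theorem subst_coshSubOneSeries_of_isEpsilon {ε : ℕ → ℚ} (hε : IsEpsilon ε) :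
    (PowerSeries.mk fun i => 2 ^ i * ε i).subst coshSubOneSeries = sinhSeries := by
  ext l
  rw [coeff_subst' hasSubst_coshSubOneSeries]
  rcases Nat.eq_zero_or_pos l with rfl | hl
  · rw [finsum_eq_single _ 0]
    · simp [hε.1, sinhSeries]
    · intro i hi
      simp [coshSubOneSeries, hi]
  · simp only [sinhSeries, coeff_mk]
    rw [hε.2 l hl, finsum_eq_sum_of_support_subset (s := Finset.Icc 1 l)]
    · refine Finset.sum_congr rfl fun i _ => ?_
      rw [coeff_coshSubOneSeries_pow, smul_eq_mul, Finset.mul_sum]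
      exact Finset.sum_congr rfl fun c _ => by rw [mul_one_div]
    · intro i hi
      rw [coe_Icc, Set.mem_Icc]
      by_contra hil
      refine hi ?_
      dsimp only
      rw [coeff_coshSubOneSeries_pow, Finset.sum_eq_zero, smul_zero]
      intro c hc
      exfalso
      simp only [mem_filter, Fintype.mem_piFinset, mem_Icc] at hc
      have hle : ∑ _t : Fin i, 1 ≤ ∑ t, c t := Finset.sum_le_sum fun t _ => (hc.1 t).1
      simp only [sum_const, card_univ, Fintype.card_fin, smul_eq_mul, mul_one] at hle
      have hi0 : i = 0 := by omega
      subst hi0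
      have := hc.2
      simp at this
      omega

theorem two_mul_derivative_coshSubOneSeries :
    2 * d⁄dX ℚ coshSubOneSeries = sinhSeries := by
  ext n
  rw [← map_ofNat (C (R := ℚ)) 2, coeff_C_mul, coeff_derivative]
  simp only [coshSubOneSeries, sinhSeries, coeff_mk, Nat.succ_ne_zero, if_false,
    show 2 * (n + 1) = (2 * n + 1) + 1 by ring, Nat.factorial_succ (2 * n + 1)]
  have := Nat.factorial_ne_zero (2 * n + 1)
  push_cast
  field_simp
  ring

theorem sinhSeries_add_derivative :
    sinhSeries + 2 * X * d⁄dX ℚ sinhSeries = 1 + coshSubOneSeries := by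
  ext n
  rw [mul_assoc, ← map_ofNat (C (R := ℚ)) 2, map_add, map_add, coeff_C_mul]
  rcases n with _ | n
  · simp [sinhSeries, coshSubOneSeries]
  · rw [coeff_succ_X_mul, coeff_derivative]
    simp only [coshSubOneSeries, sinhSeries, coeff_mk, Nat.succ_ne_zero, if_false, coeff_one,
      Nat.factorial_succ (2 * (n + 1))]
    have := Nat.factorial_ne_zero (2 * (n + 1))
    push_cast
    field_simp
    ring

theorem X_mul_sinhSeries_sq :
    X * sinhSeries ^ 2 = coshSubOneSeries ^ 2 + 2 * coshSubOneSeries := by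
  apply derivative.ext
  · have h2 : d⁄dX ℚ (2 : ℚ⟦X⟧) = 0 := by
      rw [← map_ofNat (C (R := ℚ)) 2, derivative_C]
    simp only [map_add, Derivation.leibniz, derivative_pow, derivative_X, smul_eq_mul, h2]
    linear_combination sinhSeries * sinhSeries_add_derivative -
      (1 + coshSubOneSeries) * two_mul_derivative_coshSubOneSeries
  · have h0 : constantCoeff coshSubOneSeries = 0 := by
      simp [coshSubOneSeries, ← coeff_zero_eq_constantCoeff_apply]
    simp [h0]

theorem invSinh_differential_equation :
    (X ^ 2 + 2 * X) * d⁄dX ℚ invSinhSeries + (1 + X) * invSinhSeries = 1 := by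
  have hsplit : (X ^ 2 + 2 * X) * d⁄dX ℚ invSinhSeries + (1 + X) * invSinhSeries =
      X * (X * d⁄dX ℚ invSinhSeries) + C 2 * (X * d⁄dX ℚ invSinhSeries) +
        invSinhSeries + X * invSinhSeries := by
    rw [map_ofNat]; ring
  rw [hsplit]
  ext n
  simp only [invSinhSeries, map_add, coeff_C_mul]
  rcases n with _ | _ | n
  · simp [invSinhCoeff]
  · simp [coeff_succ_X_mul, coeff_derivative, invSinhCoeff, coeff_one]
    norm_num
  · simp only [coeff_succ_X_mul, coeff_derivative, coeff_mk, invSinhCoeff, coeff_one]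
    push_cast
    simp
    field_simp
    ring

theorem subst_invSinh_mul_sinhSeries :
    invSinhSeries.subst coshSubOneSeries * sinhSeries = 1 := by
  have hs := hasSubst_coshSubOneSeries
  set P : ℚ⟦X⟧ := invSinhSeries.subst coshSubOneSeries with hP
  have hode := congrArg (fun f : ℚ⟦X⟧ => f.subst coshSubOneSeries) invSinh_differential_equation
  simp only [← coe_substAlgHom hs, map_add, map_mul, map_pow, map_one, map_ofNat,
    substAlgHom_X] at hode
  simp only [coe_substAlgHom hs] at hode
  rw [← hP] at hode
  have hchain : d⁄dX ℚ P = (d⁄dX ℚ invSinhSeries).subst coshSubOneSeries *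
      d⁄dX ℚ coshSubOneSeries := derivative_subst hs
  have hS : sinhSeries ≠ 0 := fun h => by
    have := congrArg (coeff 0) h
    simp [sinhSeries] at this
  have hK : 2 * X * sinhSeries * d⁄dX ℚ P + (1 + coshSubOneSeries) * P = 1 := by
    apply mul_left_cancel₀ hS
    rw [hchain]
    linear_combination sinhSeries * hode +
      2 * (d⁄dX ℚ invSinhSeries).subst coshSubOneSeries * d⁄dX ℚ coshSubOneSeries *
        X_mul_sinhSeries_sq +
      (d⁄dX ℚ invSinhSeries).subst coshSubOneSeries *
        (coshSubOneSeries ^ 2 + 2 * coshSubOneSeries) * two_mul_derivative_coshSubOneSeries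
  have hode' : P * sinhSeries + C 2 * (X * d⁄dX ℚ (P * sinhSeries)) = 1 := by
    rw [Derivation.leibniz, smul_eq_mul, smul_eq_mul, map_ofNat]
    linear_combination hK + P * sinhSeries_add_derivative
  ext n
  have hn := congrArg (coeff n) hode'
  rw [map_add, coeff_C_mul] at hn
  rcases n with _ | n
  · simpa using hn
  · rw [coeff_succ_X_mul, coeff_derivative] at hn
    rw [coeff_one, if_neg n.succ_ne_zero] at hn ⊢
    have hfac : coeff (n + 1) (P * sinhSeries) * (1 + 2 * ((n : ℚ) + 1)) = 0 := by
      linear_combination hn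
    exact (mul_eq_zero.mp hfac).resolve_right (by positivity)

theorem subst_coshSubOneSeries_injective :
    Function.Injective fun f : ℚ⟦X⟧ => f.subst coshSubOneSeries := by
  have hc : coeff 1 coshSubOneSeries = 1 / 2 := by simp [coshSubOneSeries]
  have hu : IsUnit (coeff 1 coshSubOneSeries) := by rw [hc]; norm_num
  have h0 : constantCoeff coshSubOneSeries = 0 := by
    simp [coshSubOneSeries, ← coeff_zero_eq_constantCoeff_apply]
  refine Function.LeftInverse.injective
    (g := fun f : ℚ⟦X⟧ => f.subst (coshSubOneSeries.substInvOfIsUnit hu)) fun f => ?_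
  dsimp only
  rw [subst_comp_subst_apply hasSubst_coshSubOneSeries (HasSubst.substInvOfIsUnit _ hu),
    subst_substInvOfIsUnit_right _ h0 hu, X_subst]

theorem invSinh_mul_epsilonSeries {ε : ℕ → ℚ} (hε : IsEpsilon ε) :
    invSinhSeries * PowerSeries.mk (fun i => 2 ^ i * ε i) = 1 := by
  apply subst_coshSubOneSeries_injective
  have hs := hasSubst_coshSubOneSeries
  dsimp only
  rw [subst_mul hs, subst_coshSubOneSeries_of_isEpsilon hε, subst_invSinh_mul_sinhSeries,
    ← coe_substAlgHom hs, map_one]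

theorem padicNorm_two_odd (n : ℕ) : padicNorm 2 (2 * n + 1 : ℕ) = 1 :=
  (padicNorm.nat_eq_one_iff _).mpr (by omega)

theorem padicNorm_invSinhCoeff_succ_le (n : ℕ) :
    padicNorm 2 (invSinhCoeff (n + 1)) ≤ padicNorm 2 (invSinhCoeff n) := by
  rw [invSinhCoeff, padicNorm.mul, padicNorm.neg, padicNorm.div,
    show 2 * n + 3 = 2 * (n + 1) + 1 by ring, padicNorm_two_odd, div_one]
  exact mul_le_of_le_one_left (padicNorm.nonneg _) (padicNorm.of_nat _)

theorem padicNorm_invSinhCoeff_lt_one (n : ℕ) : padicNorm 2 (invSinhCoeff (n + 2)) < 1 := by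
  refine lt_of_le_of_lt
    (antitone_nat_of_succ_le (f := fun m => padicNorm 2 (invSinhCoeff (m + 2)))
      (fun m => padicNorm_invSinhCoeff_succ_le (m + 2)) (Nat.zero_le n)) ?_
  have h2 : invSinhCoeff (0 + 2) = 2 * ((15 : ℕ) : ℚ)⁻¹ := by
    norm_num [invSinhCoeff]
  have h15 : padicNorm 2 (15 : ℕ) = 1 := padicNorm_two_odd 7
  have hinv : padicNorm 2 (((15 : ℕ) : ℚ)⁻¹) = 1 := by
    rw [inv_eq_one_div, padicNorm.div, h15, padicNorm.one, div_one]
  have htwo : padicNorm 2 (2 : ℚ) = 2⁻¹ := by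
    simpa using padicNorm.padicNorm_p_of_prime (p := 2)
  dsimp only
  rw [h2, padicNorm.mul, hinv, htwo]
  norm_num

theorem padicNorm_three_pow (l : ℕ) : padicNorm 2 ((3 : ℚ) ^ l) = 1 := by
  have h3 : padicNorm 2 (3 : ℚ) = 1 := by exact_mod_cast padicNorm_two_odd 1
  induction l with
  | zero => simp
  | succ l ih => rw [pow_succ, padicNorm.mul, ih, h3, one_mul]

theorem padicNorm_three_pow_mul_sub_one_lt_one {e : ℕ → ℚ}
    (he : invSinhSeries * PowerSeries.mk e = 1) (l : ℕ) : padicNorm 2 (3 ^ l * e l - 1) < 1 := by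
  induction l using Nat.strong_induction_on with
  | _ l ih =>
    have hcoeff := congrArg (coeff l) he
    rw [coeff_mul, Finset.Nat.sum_antidiagonal_eq_sum_range_succ_mk] at hcoeff
    simp only [invSinhSeries, coeff_mk, coeff_one] at hcoeff
    rcases l with _ | l
    · simp [invSinhCoeff] at hcoeff
      simp [hcoeff]
    · rw [if_neg l.succ_ne_zero, Nat.succ_eq_add_one, Finset.sum_range_succ',
        Finset.sum_range_succ'] at hcoeff
      have hrec : 3 ^ (l + 1) * e (l + 1) - 1 = (3 ^ l * e l - 1) -
          3 ^ (l + 1) * ∑ k ∈ range l, invSinhCoeff (k + 1 + 1) * e (l + 1 - (k + 1 + 1)) := by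
        have h1 : invSinhCoeff (0 + 1) = -(1 / 3) := by norm_num [invSinhCoeff]
        have h0 : invSinhCoeff 0 = 1 := rfl
        rw [h1, h0, zero_add, Nat.sub_zero, Nat.add_sub_cancel] at hcoeff
        linear_combination 3 ^ (l + 1) * hcoeff
      rw [hrec]
      refine lt_of_le_of_lt padicNorm.sub (max_lt (ih l (Nat.lt_succ_self l)) ?_)
      rw [padicNorm.mul, padicNorm_three_pow, one_mul]
      refine padicNorm.sum_lt' (fun k hk => ?_) one_pos
      have hlt := ih (l + 1 - (k + 1 + 1)) (by omega)
      set m := l + 1 - (k + 1 + 1)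
      have hle : padicNorm 2 (e m) ≤ 1 := by
        have h := padicNorm.nonarchimedean (p := 2) (q := 3 ^ m * e m - 1) (r := 1)
        rw [sub_add_cancel, padicNorm.mul, padicNorm_three_pow, one_mul, padicNorm.one] at h
        exact h.trans (max_le hlt.le le_rfl)
      rw [padicNorm.mul]
      exact mul_lt_one_of_nonneg_of_lt_one_left (padicNorm.nonneg _)
        (padicNorm_invSinhCoeff_lt_one k) hle

theorem one_le_padicValRat_of_padicNorm_lt_one {q : ℚ} (hq : q ≠ 0) (h : padicNorm 2 q < 1) :
    1 ≤ padicValRat 2 q := by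
  rw [padicNorm.eq_zpow_of_nonzero hq, Nat.cast_ofNat,
    zpow_lt_one_iff_right₀ (by norm_num : (1 : ℚ) < 2)] at h
  omega

end EpsilonSequence

theorem epsilon_sub_six_pow_mem (ε : ℕ → ℚ) (hε : IsEpsilon ε) (l : ℕ) (hl : 1 ≤ l) :
    ε l - (6 : ℚ) ^ (-(l : ℤ)) = 0 ∨
      -(l : ℤ) + 1 ≤ padicValRat 2 (ε l - (6 : ℚ) ^ (-(l : ℤ))) := by
  refine or_iff_not_imp_left.mpr fun hne => ?_
  have hlt := EpsilonSequence.padicNorm_three_pow_mul_sub_one_lt_one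
    (EpsilonSequence.invSinh_mul_epsilonSeries hε) l
  set q : ℚ := 3 ^ l * (2 ^ l * ε l) - 1 with hq
  have hfactor : (6 : ℚ) ^ l * (ε l - (6 : ℚ) ^ (-(l : ℤ))) = q := by
    rw [zpow_neg, zpow_natCast, mul_sub, mul_inv_cancel₀ (by positivity), hq, ← mul_assoc,
      ← mul_pow]
    norm_num
  have hq0 : q ≠ 0 := by
    rw [← hfactor]
    exact mul_ne_zero (by positivity) hne
  have hval := EpsilonSequence.one_le_padicValRat_of_padicNorm_lt_one hq0 hlt
  have h6 : padicValRat 2 (6 : ℚ) = 1 := by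
    have h3 : padicValNat 2 3 = 0 := padicValNat.eq_zero_of_not_dvd (by norm_num)
    rw [show (6 : ℚ) = ((2 * 3 : ℕ) : ℚ) by norm_num, padicValRat.of_nat,
      padicValNat.mul (by norm_num) (by norm_num), h3, padicValNat_self]
    norm_num
  rw [← hfactor, padicValRat.mul (by positivity) hne, padicValRat.pow, h6] at hval
  linarith
end

section
/- For every nonzero integer k and every integer n ≥ 0, the rational number ε_n·k lies in ℤ_(2) if and only if n ≤ v_2(k). Consequently, the largest n ≥ 0 with ε_n·k ∈ ℤ_(2) is exactly v_2(k). -/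
open Finset

open PowerSeries in
/-- The power series `2 (cosh √y - 1) = ∑_{j ≥ 1} 2 y^j / (2j)!`. -/
noncomputable def twoCoshSubOne : ℚ⟦X⟧ :=
  PowerSeries.mk fun j => if j = 0 then 0 else 2 / ((2 * j).factorial : ℚ)

open PowerSeries in
/-- The power series `sinh √y / √y = ∑ y^j / (2j+1)!`. -/
noncomputable def sinhc : ℚ⟦X⟧ :=
  PowerSeries.mk fun j => 1 / ((2 * j + 1).factorial : ℚ)

/-- The coefficients `(-1)^j j! / (2j+1)‼` of the reciprocal of `∑ 2^i ε_i y^i`. -/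
def recipCoeff (j : ℕ) : ℚ :=
  (-1) ^ j * (j.factorial : ℚ) / ((2 * j + 1).doubleFactorial : ℚ)

open PowerSeries in
/-- The reciprocal of `∑ ε_i z^i`. -/
noncomputable def recipSeries : ℚ⟦X⟧ :=
  PowerSeries.mk fun j => recipCoeff j / 2 ^ j

lemma recipCoeff_zero : recipCoeff 0 = 1 := by simp [recipCoeff]

lemma recipCoeff_succ (j : ℕ) :
    (2 * j + 3) * recipCoeff (j + 1) = -((j + 1) * recipCoeff j) := by
  have h1 : ((2 * j + 1).doubleFactorial : ℚ) ≠ 0 := by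
    exact_mod_cast (Nat.doubleFactorial_pos _).ne'
  have h2 : (2 * (j : ℚ) + 3) ≠ 0 := by positivity
  have h3 : (2 * (j + 1) + 1).doubleFactorial = (2 * j + 3) * (2 * j + 1).doubleFactorial :=
    Nat.doubleFactorial_add_two (2 * j + 1)
  unfold recipCoeff
  rw [h3, Nat.factorial_succ]
  push_cast
  field_simp
  ring

lemma constantCoeff_twoCoshSubOne : PowerSeries.constantCoeff twoCoshSubOne = 0 := by
  rw [← PowerSeries.coeff_zero_eq_constantCoeff_apply]
  simp [twoCoshSubOne]

lemma hasSubst_twoCoshSubOne : PowerSeries.HasSubst twoCoshSubOne :=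
  PowerSeries.HasSubst.of_constantCoeff_zero' constantCoeff_twoCoshSubOne

open PowerSeries in
lemma derivative_twoCoshSubOne : d⁄dX ℚ twoCoshSubOne = sinhc := by
  ext n
  have h : (2 * (n + 1)).factorial = (2 * n + 2) * (2 * n + 1).factorial :=
    Nat.factorial_succ (2 * n + 1)
  have h1 : ((2 * n + 1).factorial : ℚ) ≠ 0 := by positivity
  simp only [coeff_derivative, twoCoshSubOne, sinhc, coeff_mk, h, Nat.succ_ne_zero, if_false]
  push_cast
  field_simp

open PowerSeries in
lemma sinhc_add_two_mul_X_mul_derivative :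
    2 * sinhc + 4 * (X * d⁄dX ℚ sinhc) = 2 + twoCoshSubOne := by
  ext n
  have e2 : (2 : ℚ⟦X⟧) = C (2 : ℚ) := (map_ofNat C 2).symm
  have e4 : (4 : ℚ⟦X⟧) = C (4 : ℚ) := (map_ofNat C 4).symm
  rw [e2, e4, map_add, map_add, coeff_C_mul, coeff_C_mul]
  cases n with
  | zero => simp [sinhc, twoCoshSubOne]
  | succ n =>
    have h : (2 * (n + 1) + 1).factorial = (2 * n + 3) * (2 * (n + 1)).factorial :=
      Nat.factorial_succ (2 * (n + 1))
    have h1 : ((2 * (n + 1)).factorial : ℚ) ≠ 0 := by positivity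
    rw [coeff_succ_X_mul]
    simp only [coeff_derivative, twoCoshSubOne, sinhc, coeff_mk, h, Nat.succ_ne_zero, if_false,
      coeff_C]
    push_cast
    field_simp
    ring

open PowerSeries in
lemma four_mul_X_mul_sinhc_sq :
    4 * (X * sinhc ^ 2) = 4 * twoCoshSubOne + twoCoshSubOne ^ 2 := by
  apply derivative.ext
  · have h := sinhc_add_two_mul_X_mul_derivative
    have e4 : d⁄dX ℚ (4 : ℚ⟦X⟧) = 0 := by
      rw [← map_ofNat (C (R := ℚ)) 4]; exact derivative_C
    simp only [Derivation.leibniz, pow_two, map_add, derivative_X, derivative_twoCoshSubOne,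
      smul_eq_mul, e4]
    linear_combination 2 * sinhc * h
  · simp [constantCoeff_twoCoshSubOne]

open PowerSeries in
lemma recipSeries_ode :
    (2 + X) * recipSeries + (4 * X + X ^ 2) * d⁄dX ℚ recipSeries = 2 := by
  ext n
  have e2 : (2 : ℚ⟦X⟧) = C (2 : ℚ) := (map_ofNat C 2).symm
  have e4 : (4 : ℚ⟦X⟧) = C (4 : ℚ) := (map_ofNat C 4).symm
  have e : (2 + X) * recipSeries + (4 * X + X ^ 2) * d⁄dX ℚ recipSeries =
      C 2 * recipSeries + X * (recipSeries + C 4 * d⁄dX ℚ recipSeries +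
        X * d⁄dX ℚ recipSeries) := by
    rw [e2, e4]; ring
  rw [e, e2, map_add, coeff_C_mul]
  cases n with
  | zero => simp [recipSeries, recipCoeff_zero]
  | succ n =>
    have h := recipCoeff_succ n
    have h' : coeff n (X * d⁄dX ℚ recipSeries) = n * (recipCoeff n / 2 ^ n) := by
      cases n with
      | zero => simp
      | succ n =>
        rw [coeff_succ_X_mul, coeff_derivative, recipSeries, coeff_mk]
        push_cast
        ring
    rw [coeff_succ_X_mul, map_add, map_add, coeff_C_mul, h', coeff_derivative, recipSeries,
      coeff_mk, coeff_mk, coeff_C, if_neg n.succ_ne_zero, pow_succ]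
    have h2 : (2 : ℚ) ^ n ≠ 0 := by positivity
    field_simp
    linear_combination 2 * h

open PowerSeries in
lemma sinhc_mul_subst_recipSeries :
    sinhc * recipSeries.subst twoCoshSubOne = 1 := by
  set S := sinhc with hS
  set G := recipSeries.subst twoCoshSubOne with hG
  set G' := (d⁄dX ℚ recipSeries).subst twoCoshSubOne with hG'
  have hode : (2 + twoCoshSubOne) * G + (4 * twoCoshSubOne + twoCoshSubOne ^ 2) * G' = 2 := by
    have h := congrArg (substAlgHom hasSubst_twoCoshSubOne) recipSeries_ode
    simpa only [map_add, map_mul, map_pow, map_ofNat, substAlgHom_X, coe_substAlgHom] using h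
  have hder : d⁄dX ℚ G = G' * S := by
    rw [hG, derivative_subst hasSubst_twoCoshSubOne, derivative_twoCoshSubOne]
  have hP : 4 * (X * d⁄dX ℚ (S * G)) + 2 * (S * G) = 2 := by
    rw [Derivation.leibniz, hder, smul_eq_mul, smul_eq_mul]
    linear_combination hode + G * sinhc_add_two_mul_X_mul_derivative +
      G' * four_mul_X_mul_sinhc_sq
  have e2 : (2 : ℚ⟦X⟧) = C (2 : ℚ) := (map_ofNat C 2).symm
  have e4 : (4 : ℚ⟦X⟧) = C (4 : ℚ) := (map_ofNat C 4).symm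
  ext n
  have h := congrArg (coeff n) hP
  rw [e2, e4, map_add, coeff_C_mul, coeff_C_mul] at h
  cases n with
  | zero =>
    simp only [coeff_zero_X_mul, coeff_C, if_true] at h
    rw [coeff_one, if_pos rfl]
    linarith
  | succ n =>
    rw [coeff_succ_X_mul, coeff_derivative, coeff_C, if_neg n.succ_ne_zero] at h
    rw [coeff_one, if_neg n.succ_ne_zero]
    have h0 : (4 * (n : ℚ) + 6) ≠ 0 := by positivity
    refine (mul_eq_zero.1 ?_).resolve_left h0
    linear_combination h

open PowerSeries in
lemma eq_zero_of_subst_twoCoshSubOne_eq_zero {f : ℚ⟦X⟧} (hf : f.subst twoCoshSubOne = 0) : f = 0 := by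
  by_contra h0
  have hX : (f.divXPowOrder).subst twoCoshSubOne * twoCoshSubOne ^ f.order.toNat = 0 := by
    rw [← hf]
    conv_rhs => rw [← X_pow_order_mul_divXPowOrder (f := f)]
    rw [← coe_substAlgHom hasSubst_twoCoshSubOne, map_mul, map_pow, substAlgHom_X, mul_comm]
  have hC : twoCoshSubOne ≠ 0 := by
    intro h
    have := congrArg (coeff 1) h
    simp [twoCoshSubOne] at this
  have h1 := (mul_eq_zero.1 hX).resolve_right (pow_ne_zero _ hC)
  have h2 := congrArg (coeff 0) h1
  rw [coeff_subst' hasSubst_twoCoshSubOne, finsum_eq_single _ 0] at h2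
  · exact coeff_order h0 (by simpa using h2)
  · intro i hi
    simp [constantCoeff_twoCoshSubOne, hi]

open PowerSeries in
lemma coeff_twoCoshSubOne_pow (i l : ℕ) :
    coeff l (twoCoshSubOne ^ i) =
      ∑ c ∈ (Fintype.piFinset fun _ : Fin i => Finset.Icc 1 l).filter (fun c => ∑ t, c t = l),
        2 ^ i / ∏ t, ((2 * c t).factorial : ℚ) := by
  have hpow : twoCoshSubOne ^ i = ∏ _t : Fin i, twoCoshSubOne := by simp
  rw [hpow, coeff_prod]
  symm
  refine Finset.sum_of_injOn (fun c => Finsupp.equivFunOnFinite.symm c)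
    (Finsupp.equivFunOnFinite.symm.injective.injOn) ?_ ?_ ?_
  · intro c hc
    simp only [Finset.coe_filter, Set.mem_ofPred_eq] at hc
    simp [Finset.mem_finsuppAntidiag, hc.2]
  · intro c hc hc'
    rw [Finset.mem_finsuppAntidiag] at hc
    by_contra hne
    rw [← ne_eq, Finset.prod_ne_zero_iff] at hne
    refine hc' ⟨c, ?_, by simp⟩
    simp only [Finset.coe_filter, Set.mem_ofPred_eq, Fintype.mem_piFinset, Finset.mem_Icc]
    refine ⟨fun t => ⟨Nat.one_le_iff_ne_zero.2 fun h => hne t (Finset.mem_univ t) ?_, ?_⟩, hc.1⟩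
    · simp [h, constantCoeff_twoCoshSubOne]
    · rw [← hc.1]
      exact Finset.single_le_sum (f := fun t => c t) (fun _ _ => Nat.zero_le _) (Finset.mem_univ t)
  · intro c hc
    simp only [Finset.mem_filter, Fintype.mem_piFinset, Finset.mem_Icc] at hc
    have h : ∀ t, coeff (c t) twoCoshSubOne = 2 / ((2 * c t).factorial : ℚ) := fun t => by
      rw [twoCoshSubOne, coeff_mk, if_neg (Nat.one_le_iff_ne_zero.1 (hc.1 t).1)]
    simp [h, Finset.prod_div_distrib]

open PowerSeries in
lemma IsEpsilon.subst_twoCoshSubOne {ε : ℕ → ℚ} (hε : IsEpsilon ε) :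
    (PowerSeries.mk ε).subst twoCoshSubOne = sinhc := by
  have hXdvd : (X : ℚ⟦X⟧) ∣ twoCoshSubOne := X_dvd_iff.2 constantCoeff_twoCoshSubOne
  ext l
  rw [coeff_subst' hasSubst_twoCoshSubOne]
  have hlt : ∀ i, l < i → coeff l (twoCoshSubOne ^ i) = 0 := fun i hi =>
    X_pow_dvd_iff.1 (pow_dvd_pow_of_dvd hXdvd i) l hi
  rcases Nat.eq_zero_or_pos l with rfl | hl
  · rw [finsum_eq_single _ 0]
    · simp [hε.1, sinhc]
    · intro i hi
      rw [hlt i (Nat.pos_of_ne_zero hi), smul_zero]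
  rw [finsum_eq_sum_of_support_subset (s := Finset.Icc 1 l), sinhc, coeff_mk, hε.2 l hl]
  · refine Finset.sum_congr rfl fun i _ => ?_
    rw [coeff_twoCoshSubOne_pow, coeff_mk, smul_eq_mul, Finset.mul_sum]
    exact Finset.sum_congr rfl fun c _ => by ring
  · intro i hi
    rw [Function.mem_support] at hi
    rw [Finset.coe_Icc, Set.mem_Icc]
    refine ⟨Nat.one_le_iff_ne_zero.2 ?_, not_lt.1 fun h => hi (by rw [hlt i h, smul_zero])⟩
    rintro rfl
    exact hi (by rw [pow_zero, coeff_one, if_neg hl.ne', smul_zero])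

open PowerSeries in
lemma IsEpsilon.mk_mul_recipSeries {ε : ℕ → ℚ} (hε : IsEpsilon ε) :
    PowerSeries.mk ε * recipSeries = 1 := by
  rw [← sub_eq_zero]
  apply eq_zero_of_subst_twoCoshSubOne_eq_zero
  have h1 : (1 : ℚ⟦X⟧).subst twoCoshSubOne = (1 : ℚ⟦X⟧) := by
    rw [← coe_substAlgHom hasSubst_twoCoshSubOne, map_one]
  rw [subst_sub hasSubst_twoCoshSubOne, subst_mul hasSubst_twoCoshSubOne, h1,
    hε.subst_twoCoshSubOne, sinhc_mul_subst_recipSeries, sub_self]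

lemma padicNorm_recipCoeff (j : ℕ) :
    padicNorm 2 (recipCoeff j) = padicNorm 2 (j.factorial : ℚ) := by
  have h : padicNorm 2 ((2 * j + 1).doubleFactorial : ℚ) = 1 := by
    rw [padicNorm.nat_eq_one_iff]
    induction j with
    | zero => simp
    | succ j ih =>
      rw [show 2 * (j + 1) + 1 = 2 * j + 1 + 2 by ring, Nat.doubleFactorial_add_two,
        Nat.prime_two.dvd_mul]
      rintro (h | h)
      · omega
      · exact ih h
  rw [recipCoeff, padicNorm.div, h, padicNorm.mul, div_one]
  rcases neg_one_pow_eq_or ℚ j with h' | h' <;> simp [h']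

lemma padicNorm_recipCoeff_one : padicNorm 2 (recipCoeff 1) = 1 := by
  simp [padicNorm_recipCoeff]

lemma padicNorm_recipCoeff_lt_one {j : ℕ} (hj : 2 ≤ j) : padicNorm 2 (recipCoeff j) < 1 := by
  rw [padicNorm_recipCoeff, padicNorm.nat_lt_one_iff]
  exact Nat.dvd_factorial two_pos hj

lemma IsEpsilon.padicNorm_two_pow_mul {ε : ℕ → ℚ} (hε : IsEpsilon ε) (n : ℕ) :
    padicNorm 2 (2 ^ n * ε n) = 1 := by
  induction n using Nat.strong_induction_on with
  | _ n ih =>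
  rcases Nat.lt_or_ge n 1 with hn | hn
  · obtain rfl : n = 0 := by omega
    simp [hε.1]
  obtain ⟨m, rfl⟩ : ∃ m, n = m + 1 := ⟨n - 1, by omega⟩
  have hconv : ∑ i ∈ Finset.range (m + 2), 2 ^ (m + 1 - i) * ε (m + 1 - i) * recipCoeff i = 0 := by
    have h := congrArg (PowerSeries.coeff (m + 1)) hε.mk_mul_recipSeries
    rw [mul_comm, PowerSeries.coeff_mul, PowerSeries.coeff_one, if_neg m.succ_ne_zero,
      Finset.Nat.sum_antidiagonal_eq_sum_range_succ
        (fun i j => PowerSeries.coeff i recipSeries * PowerSeries.coeff j (PowerSeries.mk ε))] at h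
    rw [← mul_zero ((2 : ℚ) ^ (m + 1)), ← h, Finset.mul_sum]
    refine Finset.sum_congr rfl fun i hi => ?_
    rw [PowerSeries.coeff_mk, recipSeries, PowerSeries.coeff_mk,
      pow_sub₀ (2 : ℚ) two_ne_zero (Nat.lt_succ_iff.1 (Finset.mem_range.1 hi))]
    ring
  rw [Finset.sum_range_succ', Finset.sum_range_succ'] at hconv
  simp only [zero_add, Nat.sub_zero, Nat.add_sub_cancel, recipCoeff_zero, mul_one] at hconv
  set R := ∑ i ∈ Finset.range m,
    2 ^ (m + 1 - (i + 1 + 1)) * ε (m + 1 - (i + 1 + 1)) * recipCoeff (i + 1 + 1) with hR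
  have hRlt : padicNorm 2 R < 1 := by
    refine padicNorm.sum_lt' (fun i _ => ?_) one_pos
    rw [padicNorm.mul, ih _ (by omega), one_mul]
    exact padicNorm_recipCoeff_lt_one (by omega)
  have hlead : padicNorm 2 (2 ^ m * ε m * recipCoeff 1) = 1 := by
    rw [padicNorm.mul, ih m (by omega), padicNorm_recipCoeff_one, one_mul]
  have hsplit : 2 ^ (m + 1) * ε (m + 1) = -(R + 2 ^ m * ε m * recipCoeff 1) := by
    linear_combination hconv
  rw [hsplit, padicNorm.neg, padicNorm.add_eq_max_of_ne (by rw [hlead]; exact hRlt.ne), hlead,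
    max_eq_right hRlt.le]

lemma IsEpsilon.padicValRat_eq {ε : ℕ → ℚ} (hε : IsEpsilon ε) (n : ℕ) :
    ε n ≠ 0 ∧ padicValRat 2 (ε n) = -n := by
  have h := hε.padicNorm_two_pow_mul n
  have h0 : ε n ≠ 0 := by
    intro h0
    simp [h0] at h
  refine ⟨h0, ?_⟩
  have h2 : (2 : ℚ) ^ n ≠ 0 := by positivity
  rw [padicNorm.eq_zpow_of_nonzero (mul_ne_zero h2 h0), padicValRat.mul h2 h0,
    padicValRat.pow] at h
  have hself : padicValRat 2 (2 : ℚ) = 1 := by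
    exact_mod_cast padicValRat.self (p := 2) one_lt_two
  rw [hself, zpow_eq_one_iff_right₀ (by norm_num) (by norm_num)] at h
  omega

theorem epsilon_mul_mem_int_two_iff (ε : ℕ → ℚ) (hε : IsEpsilon ε) (k : ℤ) (hk : k ≠ 0) :
    (∀ n : ℕ, 0 ≤ padicValRat 2 (ε n * (k : ℚ)) ↔ n ≤ padicValInt 2 k) ∧
      IsGreatest {n : ℕ | 0 ≤ padicValRat 2 (ε n * (k : ℚ))} (padicValInt 2 k) := by
  have key : ∀ n : ℕ, 0 ≤ padicValRat 2 (ε n * (k : ℚ)) ↔ n ≤ padicValInt 2 k := by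
    intro n
    obtain ⟨h0, hv⟩ := hε.padicValRat_eq n
    rw [padicValRat.mul h0 (by exact_mod_cast hk), hv, padicValRat.of_int]
    omega
  exact ⟨key, (key _).2 le_rfl, fun n hn => (key n).1 hn⟩
end

section
/- Let p be an odd prime and n ≥ 1 an integer. Then ε_{n(p−1)/2} − (−1)^{n(p+1)/2} · (((p−1)/2)!)^{2n} / (p!)^n lies in p^{−n+1}·ℤ_(p); equivalently, the difference has p-adic valuation at least −n+1 when nonzero. -/
open Finset

namespace EpsilonSequence

open PowerSeries

/-- The series `∑ y ^ l / (2 l)!`, that is, `cosh √y`. -/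
noncomputable def coshSqrt : ℚ⟦X⟧ := PowerSeries.mk fun l => 1 / ((2 * l).factorial : ℚ)

/-- The series `∑ y ^ l / (2 l + 1)!`, that is, `sinh √y / √y`. -/
noncomputable def sinhcSqrt : ℚ⟦X⟧ := PowerSeries.mk fun l => 1 / ((2 * l + 1).factorial : ℚ)

/-- The series `2 (cosh √y - 1)`. -/
noncomputable def versine : ℚ⟦X⟧ := 2 * (coshSqrt - 1)

/-- The coefficients of the inverse of the generating function of the sequence `ε`. -/
def invCoeff (k : ℕ) : ℚ := (-1) ^ k * (k.factorial : ℚ) ^ 2 / ((2 * k + 1).factorial : ℚ)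

lemma invCoeff_zero : invCoeff 0 = 1 := by simp [invCoeff]

lemma invCoeff_succ (k : ℕ) :
    2 * (2 * k + 3) * invCoeff (k + 1) + (k + 1) * invCoeff k = 0 := by
  have h : (2 * (k + 1) + 1).factorial = (2 * k + 3) * ((2 * k + 2) * (2 * k + 1).factorial) := by
    rw [show 2 * (k + 1) + 1 = (2 * k + 2) + 1 by ring, Nat.factorial_succ, Nat.factorial_succ]
  have h0 : ((2 * k + 1).factorial : ℚ) ≠ 0 := by exact_mod_cast (2 * k + 1).factorial_ne_zero
  rw [invCoeff, invCoeff, h, Nat.factorial_succ]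
  push_cast
  have h1 : (2 * (k : ℚ) + 3) ≠ 0 := by positivity
  have h2 : (2 * (k : ℚ) + 2) ≠ 0 := by positivity
  field_simp
  ring

lemma constantCoeff_coshSqrt : constantCoeff coshSqrt = 1 := by
  simp [coshSqrt, ← coeff_zero_eq_constantCoeff_apply]

lemma constantCoeff_sinhcSqrt : constantCoeff sinhcSqrt = 1 := by
  simp [sinhcSqrt, ← coeff_zero_eq_constantCoeff_apply]

lemma constantCoeff_versine : constantCoeff versine = 0 := by
  simp [versine, constantCoeff_coshSqrt]

lemma hasSubst_versine : HasSubst versine :=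
  HasSubst.of_constantCoeff_zero' constantCoeff_versine

lemma coeff_versine {l : ℕ} (hl : l ≠ 0) :
    coeff l versine = 2 / ((2 * l).factorial : ℚ) := by
  rw [versine, show (2 : ℚ⟦X⟧) = C (2 : ℚ) from (map_ofNat C 2).symm, coeff_C_mul, map_sub,
    coeff_one, if_neg hl, coshSqrt, coeff_mk]
  ring

lemma derivative_coshSqrt : 2 * derivative ℚ coshSqrt = sinhcSqrt := by
  ext n
  rw [show (2 : ℚ⟦X⟧) = C (2 : ℚ) from (map_ofNat C 2).symm, coeff_C_mul, coeff_derivative,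
    coshSqrt, sinhcSqrt, coeff_mk, coeff_mk,
    show 2 * (n + 1) = (2 * n + 1) + 1 by ring, Nat.factorial_succ]
  have h0 : ((2 * n + 1).factorial : ℚ) ≠ 0 := by exact_mod_cast (2 * n + 1).factorial_ne_zero
  push_cast
  field_simp
  ring

lemma derivative_versine : derivative ℚ versine = sinhcSqrt := by
  rw [versine, Derivation.leibniz, ← derivative_coshSqrt]
  have h2 : derivative ℚ (2 : ℚ⟦X⟧) = 0 := by
    rw [show (2 : ℚ⟦X⟧) = C (2 : ℚ) from (map_ofNat C 2).symm, derivative_C]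
  simp [h2]

lemma eq_one_of_two_X_mul_derivative_add {f : ℚ⟦X⟧}
    (h : 2 * (X * derivative ℚ f) + f = 1) : f = 1 := by
  ext n
  have hn := congrArg (coeff n) h
  rw [map_add, show (2 : ℚ⟦X⟧) = C (2 : ℚ) from (map_ofNat C 2).symm, coeff_C_mul] at hn
  cases n with
  | zero => simpa using hn
  | succ k =>
    rw [coeff_succ_X_mul, coeff_derivative, coeff_one, if_neg (Nat.succ_ne_zero k)] at hn
    rw [coeff_one, if_neg (Nat.succ_ne_zero k)]
    have h1 : (2 * (k : ℚ) + 3) ≠ 0 := by positivity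
    refine (mul_eq_zero.mp (?_ : (2 * (k : ℚ) + 3) * _ = 0)).resolve_left h1
    linear_combination hn

lemma derivative_sinhcSqrt : 2 * (X * derivative ℚ sinhcSqrt) + sinhcSqrt = coshSqrt := by
  ext n
  rw [map_add, show (2 : ℚ⟦X⟧) = C (2 : ℚ) from (map_ofNat C 2).symm, coeff_C_mul]
  cases n with
  | zero => simp [sinhcSqrt, coshSqrt]
  | succ k =>
    rw [coeff_succ_X_mul, coeff_derivative, coshSqrt, sinhcSqrt, coeff_mk, coeff_mk,
      Nat.factorial_succ (2 * (k + 1))]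
    have h0 : ((2 * (k + 1)).factorial : ℚ) ≠ 0 := by
      exact_mod_cast (2 * (k + 1)).factorial_ne_zero
    push_cast
    field_simp

lemma coshSqrt_sq : coshSqrt ^ 2 - 1 = X * sinhcSqrt ^ 2 := by
  apply derivative.ext
  · rw [map_sub, derivative_pow, Derivation.leibniz, derivative_pow, derivative_X,
      Derivation.map_one_eq_zero]
    simp only [smul_eq_mul]
    push_cast
    linear_combination (coshSqrt) * derivative_coshSqrt - sinhcSqrt * derivative_sinhcSqrt
  · simp [constantCoeff_coshSqrt]

lemma invCoeff_ode :
    (4 * X + X ^ 2) * derivative ℚ (PowerSeries.mk invCoeff) +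
      (2 + X) * PowerSeries.mk invCoeff = 2 := by
  have e4 : (4 : ℚ⟦X⟧) = C (4 : ℚ) := (map_ofNat C 4).symm
  have e2 : (2 : ℚ⟦X⟧) = C (2 : ℚ) := (map_ofNat C 2).symm
  have : (4 * X + X ^ 2) * derivative ℚ (PowerSeries.mk invCoeff) +
      (2 + X) * PowerSeries.mk invCoeff =
      X * (C 4 * derivative ℚ (PowerSeries.mk invCoeff) + X * derivative ℚ (PowerSeries.mk invCoeff) +
        PowerSeries.mk invCoeff) +
        C 2 * PowerSeries.mk invCoeff := by
    rw [← e4, ← e2]; ring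
  rw [this, e2]
  ext n
  rw [map_add, coeff_C_mul]
  cases n with
  | zero => simp [invCoeff_zero]
  | succ k =>
    rw [coeff_succ_X_mul, map_add, map_add, coeff_C_mul, coeff_C, if_neg (Nat.succ_ne_zero k),
      coeff_derivative, coeff_mk, coeff_mk]
    have := invCoeff_succ k
    cases k with
    | zero => simp at this ⊢; linarith
    | succ j =>
      rw [coeff_succ_X_mul, coeff_derivative, coeff_mk]
      push_cast at this ⊢
      linear_combination this

lemma subst_versine_mul_sinhcSqrt : (PowerSeries.mk invCoeff).subst versine * sinhcSqrt = 1 := by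
  have hs := hasSubst_versine
  have ode := congrArg (substAlgHom hs (R := ℚ)) invCoeff_ode
  have hchain := derivative_subst (f := PowerSeries.mk invCoeff) hs
  simp only [map_add, map_mul, map_pow, map_ofNat, substAlgHom_X, coe_substAlgHom] at ode
  rw [derivative_versine] at hchain
  set H := (PowerSeries.mk invCoeff).subst versine with hH
  have hode : 2 * X * sinhcSqrt * derivative ℚ H + coshSqrt * H = 1 := by
    have h2 : (2 : ℚ⟦X⟧) ≠ 0 := fun h => by
      have h' := congrArg (constantCoeff (R := ℚ)) h
      rw [map_ofNat, map_zero] at h'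
      norm_num at h'
    apply mul_left_cancel₀ h2
    rw [hchain]
    have hsq := coshSqrt_sq
    rw [versine] at ode ⊢
    linear_combination ode -
      4 * (subst (2 * (coshSqrt - 1)) (derivative ℚ (PowerSeries.mk invCoeff))) * hsq
  apply eq_one_of_two_X_mul_derivative_add
  rw [Derivation.leibniz, smul_eq_mul, smul_eq_mul]
  linear_combination hode + H * derivative_sinhcSqrt

lemma subst_versine_injective {f : ℚ⟦X⟧} (h : f.subst versine = 0) : f = 0 := by
  by_contra hf
  have hs := hasSubst_versine
  have hv : versine ≠ 0 := by
    intro h0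
    have := coeff_versine one_ne_zero
    simp [h0] at this
  have hfac := X_pow_order_mul_divXPowOrder (f := f)
  have h1 := congrArg (substAlgHom hs (R := ℚ)) hfac
  rw [map_mul, map_pow, substAlgHom_X, coe_substAlgHom, h] at h1
  have h2 := (mul_eq_zero.mp h1).resolve_left (pow_ne_zero _ hv)
  have h3 : constantCoeff (f.divXPowOrder) = 0 := by
    have hd : f.divXPowOrder = C (constantCoeff f.divXPowOrder) +
        X * (PowerSeries.mk fun n => coeff (n + 1) f.divXPowOrder) := by
      rw [add_comm]; exact eq_X_mul_shift_add_const _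
    have h4 := congrArg (substAlgHom hs (R := ℚ)) hd
    rw [map_add, map_mul, substAlgHom_X, coe_substAlgHom, h2, subst_C] at h4
    have h5 := congrArg (constantCoeff (R := ℚ)) h4
    rw [map_add, map_mul, constantCoeff_versine, zero_mul, add_zero, map_zero] at h5
    exact h5.symm
  rw [constantCoeff_divXPowOrder_eq_zero_iff] at h3
  exact hf h3

lemma coeff_versine_pow (i l : ℕ) :
    coeff l (versine ^ i) = ∑ c ∈ (Fintype.piFinset fun _ : Fin i => Finset.Icc 1 l).filter
      (fun c => ∑ t, c t = l), 2 ^ i / ∏ t, ((2 * c t).factorial : ℚ) := by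
  have : versine ^ i = ∏ _t : Fin i, versine := by simp
  rw [this, coeff_prod]
  symm
  refine Finset.sum_of_injOn (Finsupp.equivFunOnFinite.symm) (by simp) ?_ ?_ ?_
  · intro c hc
    simp only [coe_filter, Set.mem_ofPred_eq] at hc
    simpa [mem_finsuppAntidiag, Finsupp.sum_fintype] using hc.2
  · intro c hc hc'
    rw [mem_finsuppAntidiag] at hc
    by_contra hne
    rw [← ne_eq, Finset.prod_ne_zero_iff] at hne
    have hpos : ∀ t, c t ≠ 0 := by
      intro t h0
      apply hne t (mem_univ t)
      rw [h0, coeff_zero_eq_constantCoeff_apply, constantCoeff_versine]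
    apply hc'
    refine ⟨c, ?_, by simp⟩
    simp only [coe_filter, Set.mem_ofPred_eq, Fintype.mem_piFinset, mem_Icc]
    refine ⟨fun t => ⟨Nat.one_le_iff_ne_zero.mpr (hpos t), ?_⟩, hc.1⟩
    calc c t ≤ ∑ t, c t := Finset.single_le_sum (f := fun t => c t) (by simp) (mem_univ t)
      _ = l := hc.1
  · intro c hc
    simp only [mem_filter, Fintype.mem_piFinset, mem_Icc] at hc
    have hcoeff : ∀ t, coeff (Finsupp.equivFunOnFinite.symm c t) versine =
        2 / ((2 * c t).factorial : ℚ) := fun t => by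
      rw [Finsupp.equivFunOnFinite_symm_apply_apply]
      exact coeff_versine (Nat.one_le_iff_ne_zero.mp (hc.1 t).1)
    rw [Finset.prod_congr rfl fun t _ => hcoeff t, Finset.prod_div_distrib]
    simp

lemma subst_versine_eq {ε : ℕ → ℚ} (hε : IsEpsilon ε) :
    (PowerSeries.mk ε).subst versine = sinhcSqrt := by
  have hs := hasSubst_versine
  have hX : X ∣ versine := X_dvd_iff.mpr constantCoeff_versine
  ext l
  rw [coeff_subst' hs, finsum_eq_sum_of_support_subset (s := Finset.range (l + 1))]
  · rcases Nat.eq_zero_or_pos l with rfl | hl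
    · simp [hε.1, sinhcSqrt]
    · rw [Finset.sum_range_succ', sinhcSqrt, coeff_mk (R := ℚ) l, hε.2 l hl, pow_zero, coeff_one,
        if_neg hl.ne', smul_zero, add_zero, Finset.range_eq_Ico,
        Finset.sum_Ico_add' (fun i => coeff i (PowerSeries.mk ε) • coeff l (versine ^ i)) 0 l 1,
        zero_add, Finset.Ico_add_one_right_eq_Icc]
      refine Finset.sum_congr rfl fun i _ => ?_
      rw [coeff_versine_pow, coeff_mk, smul_eq_mul, Finset.mul_sum]
      refine Finset.sum_congr rfl fun c _ => ?_
      ring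
  · intro d hd
    by_contra hlt
    simp only [coe_range, Set.mem_Iio, not_lt] at hlt
    apply hd
    simp only
    rw [X_pow_dvd_iff.mp (pow_dvd_pow_of_dvd hX d) l (by omega), smul_zero]

lemma mk_mul_mk_invCoeff {ε : ℕ → ℚ} (hε : IsEpsilon ε) :
    PowerSeries.mk ε * PowerSeries.mk invCoeff = 1 := by
  have hs := hasSubst_versine
  rw [← sub_eq_zero]
  apply subst_versine_injective
  rw [subst_sub hs, subst_mul hs, subst_versine_eq hε, mul_comm, subst_versine_mul_sinhcSqrt,
    ← coe_substAlgHom hs, map_one, sub_self]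

lemma epsilon_succ {ε : ℕ → ℚ} (hε : IsEpsilon ε) (N : ℕ) :
    ε (N + 1) = -∑ k ∈ range (N + 1), invCoeff (k + 1) * ε (N - k) := by
  have h := congrArg (coeff (N + 1)) (mk_mul_mk_invCoeff hε)
  rw [mul_comm, coeff_mul, Finset.Nat.sum_antidiagonal_eq_sum_range_succ_mk,
    Finset.sum_range_succ', coeff_one, if_neg (Nat.succ_ne_zero N)] at h
  simp only [coeff_mk, invCoeff_zero, one_mul, Nat.sub_zero, Nat.add_sub_add_right] at h
  linear_combination h

lemma padicValNat_factorial_le_log (p k : ℕ) [Fact p.Prime] :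
    padicValNat p (2 * k + 1).factorial ≤
      2 * padicValNat p k.factorial + Nat.log p (2 * k + 1) := by
  have hk : Nat.log p k < Nat.log p (2 * k + 1) + 1 :=
    Nat.lt_succ_of_le (Nat.log_mono_right (by omega))
  rw [padicValNat_factorial (Nat.lt_succ_self (Nat.log p (2 * k + 1))),
    padicValNat_factorial hk, Finset.mul_sum]
  calc ∑ i ∈ Finset.Ico 1 (Nat.log p (2 * k + 1) + 1), (2 * k + 1) / p ^ i
      ≤ ∑ i ∈ Finset.Ico 1 (Nat.log p (2 * k + 1) + 1), (2 * (k / p ^ i) + 1) := by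
        refine Finset.sum_le_sum fun i _ => ?_
        have hpos : 0 < p ^ i := pow_pos (Fact.out : p.Prime).pos i
        rw [← Nat.lt_succ_iff, Nat.div_lt_iff_lt_mul hpos]
        have := Nat.lt_div_mul_add (a := k) hpos
        rw [Nat.succ_eq_add_one]
        nlinarith
    _ = _ := by rw [Finset.sum_add_distrib]; simp

lemma padicNorm_invCoeff_le_log (p k : ℕ) [Fact p.Prime] :
    padicNorm p (invCoeff k) ≤ (p : ℚ) ^ Nat.log p (2 * k + 1) := by
  have hp1 : (1 : ℚ) ≤ p := by exact_mod_cast (Fact.out : p.Prime).one_lt.le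
  have hp0 : (p : ℚ) ≠ 0 := by positivity
  have h1 : (k.factorial : ℚ) ≠ 0 := by exact_mod_cast k.factorial_ne_zero
  have h2 : ((2 * k + 1).factorial : ℚ) ≠ 0 := by exact_mod_cast (2 * k + 1).factorial_ne_zero
  have hsign : padicNorm p ((-1) ^ k) = 1 := by
    rcases neg_one_pow_eq_or ℚ k with h | h <;> simp [h]
  rw [invCoeff, padicNorm.div, padicNorm.mul, hsign, one_mul, pow_two, padicNorm.mul,
    padicNorm.eq_zpow_of_nonzero h1, padicNorm.eq_zpow_of_nonzero h2, ← zpow_add₀ hp0,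
    ← zpow_sub₀ hp0, ← zpow_natCast]
  apply zpow_le_zpow_right₀ hp1
  have := padicValNat_factorial_le_log p k
  rw [padicValRat.of_nat, padicValRat.of_nat]
  omega

lemma log_le_div {m : ℕ} (hm : 0 < m) (k : ℕ) :
    Nat.log (2 * m + 1) (2 * k + 1) ≤ k / m := by
  rw [Nat.le_div_iff_mul_le hm]
  have h1 := Nat.pow_log_le_self (2 * m + 1) (x := 2 * k + 1) (by omega)
  set L := Nat.log (2 * m + 1) (2 * k + 1)
  have h2 : 1 + L * (2 * m) ≤ (1 + 2 * m) ^ L := by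
    have h := one_add_mul_le_pow (a := 2 * (m : ℤ)) (by omega) L
    exact_mod_cast h
  rw [add_comm 1 (2 * m)] at h2
  nlinarith

lemma log_mul_lt {m j : ℕ} (hm : 0 < m) (hj : 2 ≤ j) :
    Nat.log (2 * m + 1) (2 * (j * m) + 1) < j := by
  apply Nat.log_lt_of_lt_pow (by omega)
  induction j, hj using Nat.le_induction with
  | base => nlinarith
  | succ j hj ih =>
    rw [pow_succ]
    calc 2 * ((j + 1) * m) + 1 ≤ (2 * (j * m) + 1) * (2 * m + 1) := by ring_nf; omega
      _ < (2 * m + 1) ^ j * (2 * m + 1) := Nat.mul_lt_mul_of_pos_right ih (by omega)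

section Recurrence

variable {p m : ℕ} [Fact p.Prime] {f : ℕ → ℚ}

lemma padicNorm_le_of_recurrence (hm : 0 < m) (hpm : p = 2 * m + 1) (h0 : f 0 = 1)
    (hf : ∀ N, f (N + 1) = -∑ k ∈ range (N + 1), invCoeff (k + 1) * f (N - k)) (N : ℕ) :
    padicNorm p (f N) ≤ (p : ℚ) ^ (N / m) := by
  have hp1 : (1 : ℚ) ≤ p := by exact_mod_cast (Fact.out : p.Prime).one_lt.le
  induction N using Nat.strong_induction_on with
  | _ N ih =>
    cases N with
    | zero => simp [h0]
    | succ N =>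
      rw [hf, padicNorm.neg]
      refine padicNorm.sum_le' (fun k hk => ?_) (by positivity)
      have hk' := Finset.mem_range.mp hk
      rw [padicNorm.mul]
      calc padicNorm p (invCoeff (k + 1)) * padicNorm p (f (N - k))
          ≤ (p : ℚ) ^ ((k + 1) / m) * (p : ℚ) ^ ((N - k) / m) := by
            refine mul_le_mul ((padicNorm_invCoeff_le_log p (k + 1)).trans ?_)
              (ih (N - k) (by omega)) (padicNorm.nonneg _) (by positivity)
            refine pow_le_pow_right₀ hp1 ?_
            subst hpm
            exact log_le_div hm _
        _ ≤ (p : ℚ) ^ ((N + 1) / m) := by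
            rw [← pow_add]
            refine pow_le_pow_right₀ hp1 ?_
            have h := Nat.div_add_div_le_add_div (x := k + 1) (y := N - k) (z := m)
            rwa [show k + 1 + (N - k) = N + 1 by omega] at h

lemma padicNorm_sub_pow_le_of_recurrence (hm : 0 < m) (hpm : p = 2 * m + 1) (h0 : f 0 = 1)
    (hf : ∀ N, f (N + 1) = -∑ k ∈ range (N + 1), invCoeff (k + 1) * f (N - k)) (n : ℕ) :
    padicNorm p (f ((n + 1) * m) - (-invCoeff m) ^ (n + 1)) ≤ (p : ℚ) ^ n := by
  have hp1 : (1 : ℚ) ≤ p := by exact_mod_cast (Fact.out : p.Prime).one_lt.le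
  have hbound := padicNorm_le_of_recurrence hm hpm h0 hf
  have hother : ∀ n : ℕ, padicNorm p (f ((n + 1) * m) + invCoeff m * f (n * m)) ≤
      (p : ℚ) ^ n := by
    intro n
    obtain ⟨N, hN⟩ : ∃ N, (n + 1) * m = N + 1 :=
      Nat.exists_eq_succ_of_ne_zero (by positivity)
    have hN' : n * m + m = N + 1 := by rw [← hN]; ring
    have hmem : m - 1 ∈ range (N + 1) := Finset.mem_range.mpr (by omega)
    rw [hN, hf, ← Finset.add_sum_erase _ _ hmem, show m - 1 + 1 = m by omega,
      show N - (m - 1) = n * m by omega]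
    rw [neg_add_rev, neg_add_cancel_right, padicNorm.neg]
    refine padicNorm.sum_le' (fun k hk => ?_) (by positivity)
    obtain ⟨hkm, hk⟩ := Finset.mem_erase.mp hk
    rw [Finset.mem_range] at hk
    rw [padicNorm.mul]
    have hlog : Nat.log p (2 * (k + 1) + 1) + (N - k) / m ≤ n := by
      subst hpm
      by_cases hd : m ∣ k + 1
      · obtain ⟨j, hj⟩ := hd
        have hj2 : 2 ≤ j := by
          rcases j with _ | _ | j
          · omega
          · omega
          · omega
        have h1 := log_mul_lt hm hj2
        have h2 : (N - k) / m + j = n + 1 := by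
          rw [← Nat.add_mul_div_left _ _ hm, ← hj, show N - k + (k + 1) = N + 1 by omega, ← hN,
            Nat.mul_div_cancel _ hm]
        rw [mul_comm j m, ← hj] at h1
        omega
      · have h1 := log_le_div hm (k + 1)
        have h2 : (k + 1) / m + (N - k) / m < n + 1 := by
          by_contra! hcon
          apply hd
          have e1 := Nat.div_mul_le_self (k + 1) m
          have e2 := Nat.div_mul_le_self (N - k) m
          have e3 : (n + 1) * m ≤ (k + 1) / m * m + (N - k) / m * m := by
            rw [← add_mul]; exact Nat.mul_le_mul_right m hcon
          exact ⟨(k + 1) / m, by rw [mul_comm]; omega⟩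
        omega
    calc padicNorm p (invCoeff (k + 1)) * padicNorm p (f (N - k))
        ≤ (p : ℚ) ^ Nat.log p (2 * (k + 1) + 1) * (p : ℚ) ^ ((N - k) / m) :=
          mul_le_mul (padicNorm_invCoeff_le_log p (k + 1)) (hbound _)
            (padicNorm.nonneg _) (by positivity)
      _ ≤ (p : ℚ) ^ n := by
          rw [← pow_add]
          exact pow_le_pow_right₀ hp1 hlog
  have hm1 : padicNorm p (invCoeff m) ≤ p := by
    refine (padicNorm_invCoeff_le_log p m).trans ?_
    have hlog := log_le_div hm m
    rw [Nat.div_self hm] at hlog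
    rw [← hpm] at hlog ⊢
    exact (pow_le_pow_right₀ hp1 hlog).trans_eq (pow_one _)
  induction n with
  | zero => simpa [h0] using hother 0
  | succ n ih =>
    have : f ((n + 1 + 1) * m) - (-invCoeff m) ^ (n + 1 + 1) =
        (f ((n + 1 + 1) * m) + invCoeff m * f ((n + 1) * m)) -
          invCoeff m * (f ((n + 1) * m) - (-invCoeff m) ^ (n + 1)) := by ring
    rw [this]
    refine padicNorm.sub.trans (max_le (hother (n + 1)) ?_)
    rw [padicNorm.mul, pow_succ' (p : ℚ)]
    exact mul_le_mul hm1 ih (padicNorm.nonneg _) (by positivity)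

end Recurrence

lemma neg_invCoeff_pow (m n : ℕ) :
    (-invCoeff m) ^ n = (-1 : ℚ) ^ (n * (m + 1)) *
      ((m.factorial : ℚ) ^ (2 * n) / ((2 * m + 1).factorial : ℚ) ^ n) := by
  rw [invCoeff, mul_comm n (m + 1), pow_mul, pow_mul, ← div_pow, ← mul_pow]
  ring

lemma neg_le_padicValRat_of_padicNorm_le {p n : ℕ} [Fact p.Prime] {q : ℚ} (hq : q ≠ 0)
    (h : padicNorm p q ≤ (p : ℚ) ^ n) : -(n : ℤ) ≤ padicValRat p q := by
  have hp1 : (1 : ℚ) < p := by exact_mod_cast (Fact.out : p.Prime).one_lt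
  rw [padicNorm.eq_zpow_of_nonzero hq, ← zpow_natCast, zpow_le_zpow_iff_right₀ hp1] at h
  omega

end EpsilonSequence

theorem epsilon_congruence_odd_prime (ε : ℕ → ℚ) (hε : IsEpsilon ε) (p : ℕ)
    (hp : p.Prime) (hodd : p ≠ 2) (n : ℕ) (hn : 1 ≤ n) :
    ε (n * (p - 1) / 2) -
        (-1 : ℚ) ^ (n * (p + 1) / 2) *
          ((((p - 1) / 2).factorial : ℚ) ^ (2 * n) / ((p.factorial : ℚ)) ^ n) = 0 ∨
      -(n : ℤ) + 1 ≤
        padicValRat p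
          (ε (n * (p - 1) / 2) -
            (-1 : ℚ) ^ (n * (p + 1) / 2) *
              ((((p - 1) / 2).factorial : ℚ) ^ (2 * n) / ((p.factorial : ℚ)) ^ n)) := by
  have : Fact p.Prime := ⟨hp⟩
  obtain ⟨m, hm⟩ := hp.odd_of_ne_two hodd
  obtain ⟨n, rfl⟩ : ∃ k, n = k + 1 := ⟨n - 1, by omega⟩
  have hm0 : 0 < m := by
    have := hp.two_le
    omega
  have h1 : (n + 1) * (p - 1) / 2 = (n + 1) * m := by
    rw [hm, show (n + 1) * (2 * m + 1 - 1) = (n + 1) * m * 2 by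
      rw [Nat.add_sub_cancel]; ring, Nat.mul_div_cancel _ two_pos]
  have h2 : (n + 1) * (p + 1) / 2 = (n + 1) * (m + 1) := by
    rw [hm, show (n + 1) * (2 * m + 1 + 1) = (n + 1) * (m + 1) * 2 by ring,
      Nat.mul_div_cancel _ two_pos]
  have h3 : (p - 1) / 2 = m := by omega
  have h4 : (p.factorial : ℚ) = ((2 * m + 1).factorial : ℚ) := by rw [hm]
  rw [h1, h2, h3, h4, ← EpsilonSequence.neg_invCoeff_pow]
  refine or_iff_not_imp_left.mpr fun hne => ?_
  have := EpsilonSequence.neg_le_padicValRat_of_padicNorm_le hne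
    (EpsilonSequence.padicNorm_sub_pow_le_of_recurrence hm0 hm hε.1
      (EpsilonSequence.epsilon_succ hε) n)
  push_cast
  omega
end

section
/- For every integer n ≥ 1, ε_{2n+1} − (−1)^n · 2^{2n}(7−2n) / ((5!)^{n−1} · 7!) lies in 5^{−n+1}·ℤ_(5); equivalently, the difference has 5-adic valuation at least −n+1 when nonzero. -/
open Finset

open PowerSeries in
/-- With `z = x ^ 2`, the series `2 * (cosh x - 1)`. -/
noncomputable def twoCoshSubTwo : ℚ⟦X⟧ :=
  mk fun l => if l = 0 then 0 else 2 / ((2 * l).factorial : ℚ)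

open PowerSeries in
/-- With `z = x ^ 2`, the series `sinh x / x`. -/
noncomputable def sinhDivX : ℚ⟦X⟧ :=
  mk fun l => 1 / ((2 * l + 1).factorial : ℚ)

/-- The coefficients of `x / sinh x` as a series in `2 * (cosh x - 1)`. -/
def arcsinhCoeff (k : ℕ) : ℚ :=
  (-1) ^ k / ((2 * k + 1 : ℕ) * (k.centralBinom : ℚ))

lemma arcsinhCoeff_zero : arcsinhCoeff 0 = 1 := by simp [arcsinhCoeff]

lemma arcsinhCoeff_succ (k : ℕ) :
    (4 * k + 6) * arcsinhCoeff (k + 1) + (k + 1) * arcsinhCoeff k = 0 := by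
  have h := congrArg (Nat.cast : ℕ → ℚ) (Nat.succ_mul_centralBinom_succ k)
  have h1 : (k.centralBinom : ℚ) ≠ 0 := by exact_mod_cast k.centralBinom_ne_zero
  have h2 : ((k + 1).centralBinom : ℚ) ≠ 0 := by exact_mod_cast (k + 1).centralBinom_ne_zero
  have h3 : (2 * (k : ℚ) + 1) ≠ 0 := by positivity
  have h4 : (2 * ((k : ℚ) + 1) + 1) ≠ 0 := by positivity
  push_cast at h
  unfold arcsinhCoeff
  push_cast
  rw [pow_succ]
  field_simp
  linear_combination (-1) ^ k * (2 * (k : ℚ) + 3) * h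

namespace PowerSeries

lemma constantCoeff_twoCoshSubTwo : constantCoeff twoCoshSubTwo = 0 := by
  simp [twoCoshSubTwo, ← coeff_zero_eq_constantCoeff_apply]

lemma hasSubst_twoCoshSubTwo : HasSubst twoCoshSubTwo :=
  HasSubst.of_constantCoeff_zero' constantCoeff_twoCoshSubTwo

lemma coeff_one_twoCoshSubTwo : coeff 1 twoCoshSubTwo = 1 := by
  simp [twoCoshSubTwo]

lemma derivative_twoCoshSubTwo : d⁄dX ℚ twoCoshSubTwo = sinhDivX := by
  ext l
  simp only [coeff_derivative, twoCoshSubTwo, sinhDivX, coeff_mk]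
  rw [if_neg (by omega), show 2 * (l + 1) = (2 * l + 1) + 1 by ring, Nat.factorial_succ]
  have := Nat.factorial_ne_zero (2 * l + 1)
  push_cast
  field_simp
  ring

lemma coeff_X_mul_derivative (f : ℚ⟦X⟧) (l : ℕ) :
    coeff l (X * d⁄dX ℚ f) = l * coeff l f := by
  cases l with
  | zero => simp
  | succ l => rw [coeff_succ_X_mul, coeff_derivative]; push_cast; ring

lemma coeff_two_mul (f : ℚ⟦X⟧) (l : ℕ) : coeff l (2 * f) = 2 * coeff l f := by
  rw [two_mul, map_add]; ring

lemma coeff_four_mul (f : ℚ⟦X⟧) (l : ℕ) : coeff l (4 * f) = 4 * coeff l f := by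
  rw [show (4 : ℚ⟦X⟧) = 2 * 2 by norm_num, mul_assoc, coeff_two_mul, coeff_two_mul]; ring

lemma derivative_two : d⁄dX ℚ (2 : ℚ⟦X⟧) = 0 := by
  rw [← map_ofNat C 2, derivative_C]

lemma derivative_four : d⁄dX ℚ (4 : ℚ⟦X⟧) = 0 := by
  rw [← map_ofNat C 4, derivative_C]

lemma coeff_two (l : ℕ) : coeff l (2 : ℚ⟦X⟧) = if l = 0 then 2 else 0 := by
  rw [← mul_one (2 : ℚ⟦X⟧), coeff_two_mul, coeff_one]; split_ifs <;> norm_num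

lemma derivative_sinhDivX :
    4 * (X * d⁄dX ℚ sinhDivX) + 2 * sinhDivX = twoCoshSubTwo + 2 := by
  ext l
  simp only [map_add, coeff_four_mul, coeff_two_mul, coeff_X_mul_derivative, coeff_two]
  simp only [twoCoshSubTwo, sinhDivX, coeff_mk]
  by_cases hl : l = 0
  · subst hl; simp
  · simp only [hl, if_false]
    rw [Nat.factorial_succ]
    have := Nat.factorial_ne_zero (2 * l)
    push_cast
    field_simp
    ring

lemma twoCoshSubTwo_quadratic :
    4 * twoCoshSubTwo + twoCoshSubTwo ^ 2 = 4 * (X * sinhDivX ^ 2) := by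
  apply derivative.ext
  · simp only [map_add, Derivation.leibniz, Derivation.leibniz_pow, derivative_four,
      derivative_twoCoshSubTwo, derivative_X, smul_eq_mul, nsmul_eq_mul]
    linear_combination (-2 * sinhDivX) * derivative_sinhDivX
  · simp [constantCoeff_twoCoshSubTwo]

lemma mk_arcsinhCoeff_ode :
    (4 * X + X ^ 2) * d⁄dX ℚ (mk arcsinhCoeff) + (2 + X) * mk arcsinhCoeff = 2 := by
  have : (4 * X + X ^ 2) * d⁄dX ℚ (mk arcsinhCoeff) + (2 + X) * mk arcsinhCoeff =
      4 * (X * d⁄dX ℚ (mk arcsinhCoeff)) + 2 * mk arcsinhCoeff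
        + X * (X * d⁄dX ℚ (mk arcsinhCoeff) + mk arcsinhCoeff) := by ring
  rw [this]
  ext l
  cases l with
  | zero => simp [arcsinhCoeff_zero, map_ofNat constantCoeff 2]
  | succ l =>
    rw [map_add, map_add, coeff_succ_X_mul]
    simp only [map_add, coeff_four_mul, coeff_two_mul, coeff_X_mul_derivative, coeff_two,
      coeff_mk]
    have := arcsinhCoeff_succ l
    simp only [Nat.succ_ne_zero, if_false]
    push_cast
    linear_combination this

lemma subst_mk_arcsinhCoeff_mul_sinhDivX :
    (mk arcsinhCoeff).subst twoCoshSubTwo * sinhDivX = 1 := by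
  have hs := hasSubst_twoCoshSubTwo
  have hode := congrArg (substAlgHom (R := ℚ) hs) mk_arcsinhCoeff_ode
  simp only [map_add, map_mul, map_pow, map_ofNat, substAlgHom_X] at hode
  rw [coe_substAlgHom] at hode
  have hchain := derivative_subst (f := mk arcsinhCoeff) hs
  rw [derivative_twoCoshSubTwo] at hchain
  set B : ℚ⟦X⟧ := (mk arcsinhCoeff).subst twoCoshSubTwo with hB
  set B' : ℚ⟦X⟧ := (d⁄dX ℚ (mk arcsinhCoeff)).subst twoCoshSubTwo with hB'
  have key : 4 * (X * d⁄dX ℚ (B * sinhDivX)) + 2 * (B * sinhDivX) = 2 := by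
    simp only [Derivation.leibniz, smul_eq_mul, hchain]
    linear_combination hode - B' * twoCoshSubTwo_quadratic + B * derivative_sinhDivX
  ext l
  have h := congrArg (coeff l) key
  simp only [map_add, coeff_four_mul, coeff_two_mul, coeff_X_mul_derivative, coeff_two] at h
  rw [coeff_one]
  split_ifs with hl
  · subst hl; simp at h; simpa using h
  · rw [if_neg hl] at h
    have : (4 * (l : ℚ) + 2) ≠ 0 := by positivity
    exact (mul_eq_zero.mp (by linear_combination h :
      (4 * (l : ℚ) + 2) * coeff l (B * sinhDivX) = 0)).resolve_left this

lemma coeff_twoCoshSubTwo_pow (i l : ℕ) :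
    coeff l (twoCoshSubTwo ^ i) =
      ∑ c ∈ (Fintype.piFinset fun _ : Fin i => Finset.Icc 1 l).filter
        (fun c => ∑ t, c t = l), 2 ^ i / ∏ t, ((2 * c t).factorial : ℚ) := by
  have hprod : twoCoshSubTwo ^ i = ∏ _t : Fin i, twoCoshSubTwo := by simp
  rw [hprod, coeff_prod]
  symm
  refine Finset.sum_of_injOn (fun c => Finsupp.equivFunOnFinite.symm c)
    (Finsupp.equivFunOnFinite.symm.injective.injOn) ?_ ?_ ?_
  · intro c hc
    simp only [Finset.coe_filter, Set.mem_ofPred_eq] at hc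
    simp [Finset.mem_finsuppAntidiag, hc.2]
  · intro f hf hf'
    simp only [Finset.mem_finsuppAntidiag] at hf
    have : ∃ t, f t = 0 := by
      by_contra! hne
      refine hf' ⟨f, ?_, by ext; simp⟩
      simp only [Finset.coe_filter, Set.mem_ofPred_eq, Fintype.mem_piFinset, Finset.mem_Icc]
      refine ⟨fun t => ⟨Nat.one_le_iff_ne_zero.mpr (hne t), ?_⟩, hf.1⟩
      rw [← hf.1]
      exact Finset.single_le_sum (f := fun t => f t) (fun _ _ => Nat.zero_le _)
        (Finset.mem_univ t)
    obtain ⟨t, ht⟩ := this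
    exact Finset.prod_eq_zero (Finset.mem_univ t) (by simp [ht, twoCoshSubTwo])
  · intro c hc
    simp only [Finset.mem_filter, Fintype.mem_piFinset, Finset.mem_Icc] at hc
    have : ∀ t, coeff (c t) twoCoshSubTwo = 2 / ((2 * c t).factorial : ℚ) := fun t => by
      have := (hc.1 t).1
      rw [twoCoshSubTwo, coeff_mk, if_neg (by omega)]
    simp [this, Finset.prod_div_distrib]

lemma coeff_twoCoshSubTwo_pow_of_lt {i l : ℕ} (h : l < i) :
    coeff l (twoCoshSubTwo ^ i) = 0 :=
  coeff_of_lt_order _ (lt_of_lt_of_le (by exact_mod_cast h)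
    (le_order_pow_of_constantCoeff_eq_zero i constantCoeff_twoCoshSubTwo))

end PowerSeries

open PowerSeries in
lemma IsEpsilon.subst_mk {ε : ℕ → ℚ} (hε : IsEpsilon ε) :
    (mk ε).subst twoCoshSubTwo = sinhDivX := by
  ext l
  rw [coeff_subst' hasSubst_twoCoshSubTwo,
    finsum_eq_sum_of_support_subset (s := Finset.range (l + 1))]
  · simp only [coeff_mk, smul_eq_mul, sinhDivX]
    rcases Nat.eq_zero_or_pos l with rfl | hl
    · simp [hε.1]
    · rw [hε.2 l hl, Finset.sum_range_succ', pow_zero, coeff_one, if_neg hl.ne', mul_zero,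
        add_zero, Finset.range_eq_Ico,
        Finset.sum_Ico_add' (fun i => ε i * coeff l (twoCoshSubTwo ^ i)) 0 l 1]
      refine Finset.sum_congr (by ext; simp) fun i _ => ?_
      rw [coeff_twoCoshSubTwo_pow, Finset.mul_sum]
      exact Finset.sum_congr rfl fun c _ => by ring
  · intro i hi
    simp only [Finset.coe_range, Set.mem_Iio]
    by_contra hlt
    exact hi (by simp [coeff_twoCoshSubTwo_pow_of_lt (show l < i by omega)])

open PowerSeries in
lemma IsEpsilon.mk_arcsinhCoeff_mul_mk {ε : ℕ → ℚ} (hε : IsEpsilon ε) :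
    mk arcsinhCoeff * mk ε = 1 := by
  have hs := hasSubst_twoCoshSubTwo
  have h : (mk arcsinhCoeff * mk ε).subst twoCoshSubTwo = (1 : ℚ⟦X⟧) := by
    rw [subst_mul hs, hε.subst_mk, subst_mk_arcsinhCoeff_mul_sinhDivX]
  let _ : Invertible (twoCoshSubTwo.coeff 1) := by
    rw [coeff_one_twoCoshSubTwo]; exact invertibleOne
  have hinv : twoCoshSubTwo.subst twoCoshSubTwo.substInv = X :=
    subst_substInv_right _ constantCoeff_twoCoshSubTwo
  have hs' : HasSubst twoCoshSubTwo.substInv := HasSubst.substInv _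
  have h1 := congrArg (subst (R := ℚ) twoCoshSubTwo.substInv) h
  rw [subst_comp_subst_apply hs hs', hinv, X_subst] at h1
  rw [h1, ← coe_substAlgHom hs', map_one]

lemma IsEpsilon.sum_arcsinhCoeff_mul {ε : ℕ → ℚ} (hε : IsEpsilon ε) {m : ℕ} (hm : m ≠ 0) :
    ∑ k ∈ Finset.range (m + 1), arcsinhCoeff k * ε (m - k) = 0 := by
  have h := congrArg (PowerSeries.coeff m) hε.mk_arcsinhCoeff_mul_mk
  rw [PowerSeries.coeff_mul, PowerSeries.coeff_one, if_neg hm,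
    Finset.Nat.sum_antidiagonal_eq_sum_range_succ
      (fun i j => PowerSeries.coeff i (PowerSeries.mk arcsinhCoeff) *
        PowerSeries.coeff j (PowerSeries.mk ε))] at h
  simpa using h

instance factPrimeFive : Fact (Nat.Prime 5) := ⟨Nat.prime_five⟩

lemma padicNorm_five_div {a b : ℤ} (hb : ¬ (5 : ℤ) ∣ b) :
    padicNorm 5 ((a : ℚ) / b) = padicNorm 5 (a : ℚ) := by
  rw [padicNorm.div, (padicNorm.int_eq_one_iff (p := 5) b).mpr hb, div_one]

lemma padicNorm_five_div_le_one {a b : ℤ} (hb : ¬ (5 : ℤ) ∣ b) :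
    padicNorm 5 ((a : ℚ) / b) ≤ 1 := by
  rw [padicNorm_five_div hb]
  exact padicNorm.of_int a

lemma padicNorm_five_div_lt_one {a b : ℤ} (ha : (5 : ℤ) ∣ a) (hb : ¬ (5 : ℤ) ∣ b) :
    padicNorm 5 ((a : ℚ) / b) < 1 := by
  rw [padicNorm_five_div hb]
  exact (padicNorm.int_lt_one_iff a).mpr ha

lemma padicNorm_lt_one_iff {p : ℕ} [hp : Fact p.Prime] {q : ℚ} (hq : q ≠ 0) :
    padicNorm p q < 1 ↔ 1 ≤ padicValRat p q := by
  have h1 : (1 : ℚ) < p := by exact_mod_cast hp.out.one_lt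
  rw [padicNorm.eq_zpow_of_nonzero hq, ← zpow_zero (p : ℚ), zpow_lt_zpow_iff_right₀ h1]
  omega

lemma padicValRat_five_pow (d : ℕ) : padicValRat 5 ((5 : ℚ) ^ d) = d := by
  have h := padicValNat.prime_pow (p := 5) d
  rw [show (5 : ℚ) ^ d = ((5 ^ d : ℕ) : ℚ) by push_cast; rfl, padicValRat.of_nat, h]

lemma two_mul_log_five_lt {k : ℕ} (hk : 6 ≤ k) : 2 * Nat.log 5 (2 * k + 1) < k / 2 := by
  by_contra! h
  have hpow : 5 ^ Nat.log 5 (2 * k + 1) ≤ 2 * k + 1 := Nat.pow_log_le_self 5 (by omega)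
  generalize Nat.log 5 (2 * k + 1) = L at h hpow
  have hL : 2 ≤ L := by omega
  have : 8 * L + 3 < 5 ^ L := by
    clear h hpow
    induction L, hL using Nat.le_induction with
    | base => norm_num
    | succ L _ ih => rw [pow_succ]; omega
  omega

lemma padicNorm_five_arcsinhCoeff_lt_one {k : ℕ} (hk : 4 ≤ k) :
    padicNorm 5 (5 ^ (k / 2) * arcsinhCoeff k) < 1 := by
  rcases (by omega : k = 4 ∨ k = 5 ∨ 6 ≤ k) with rfl | rfl | hk
  · have : (5 : ℚ) ^ (4 / 2) * arcsinhCoeff 4 = (5 : ℤ) / (126 : ℤ) := by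
      norm_num [arcsinhCoeff, Nat.centralBinom, Nat.choose]
    rw [this]
    exact padicNorm_five_div_lt_one (by norm_num) (by norm_num)
  · have : (5 : ℚ) ^ (5 / 2) * arcsinhCoeff 5 = (-25 : ℤ) / (2772 : ℤ) := by
      norm_num [arcsinhCoeff, Nat.centralBinom, Nat.choose]
    rw [this]
    exact padicNorm_five_div_lt_one (by norm_num) (by norm_num)
  · have hc := k.centralBinom_ne_zero
    have hN : (2 * k + 1) * k.centralBinom ≠ 0 := by positivity
    have hN' : (((2 * k + 1) * k.centralBinom : ℕ) : ℚ) ≠ 0 := by exact_mod_cast hN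
    have hval : padicValNat 5 ((2 * k + 1) * k.centralBinom) < k / 2 := by
      rw [padicValNat.mul (by omega) hc]
      have h1 := padicValNat_le_nat_log (p := 5) (2 * k + 1)
      have h2 : padicValNat 5 k.centralBinom ≤ Nat.log 5 (2 * k) := by
        rw [← Nat.factorization_def _ Nat.prime_five]
        exact Nat.factorization_choose_le_log
      have h3 : Nat.log 5 (2 * k) ≤ Nat.log 5 (2 * k + 1) := Nat.log_mono_right (by omega)
      have := two_mul_log_five_lt hk
      omega
    have hnorm : padicNorm 5 (5 ^ (k / 2) * arcsinhCoeff k) =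
        padicNorm 5 ((5 : ℚ) ^ (k / 2) / ((2 * k + 1) * k.centralBinom : ℕ)) := by
      rcases neg_one_pow_eq_or ℚ k with h | h
      · rw [arcsinhCoeff, h]; push_cast; congr 1; ring
      · rw [arcsinhCoeff, h, ← padicNorm.neg]; push_cast; congr 1; ring
    rw [hnorm, padicNorm_lt_one_iff (div_ne_zero (by positivity) hN'),
      padicValRat.div (by positivity) hN', padicValRat_five_pow, padicValRat.of_nat]
    omega

lemma padicNorm_five_arcsinhCoeff_le_one (k : ℕ) :
    padicNorm 5 (5 ^ (k / 2) * arcsinhCoeff k) ≤ 1 := by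
  rcases lt_or_ge k 4 with hk | hk
  · have : ∃ b : ℤ, ¬ (5 : ℤ) ∣ b ∧ (5 : ℚ) ^ (k / 2) * arcsinhCoeff k = (1 : ℤ) / (b : ℤ) := by
      interval_cases k
      · exact ⟨1, by norm_num, by norm_num [arcsinhCoeff]⟩
      · exact ⟨-6, by norm_num, by norm_num [arcsinhCoeff, Nat.centralBinom]⟩
      · exact ⟨6, by norm_num, by norm_num [arcsinhCoeff, Nat.centralBinom, Nat.choose]⟩
      · exact ⟨-28, by norm_num, by norm_num [arcsinhCoeff, Nat.centralBinom, Nat.choose]⟩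
    obtain ⟨b, hb, h⟩ := this
    rw [h]
    exact padicNorm_five_div_le_one hb
  · exact (padicNorm_five_arcsinhCoeff_lt_one hk).le

lemma padicNorm_five_mul_lt_one {x y : ℚ} (hx : padicNorm 5 x < 1) (hy : padicNorm 5 y ≤ 1) :
    padicNorm 5 (x * y) < 1 := by
  rw [padicNorm.mul]
  exact mul_lt_one_of_nonneg_of_lt_one_left (padicNorm.nonneg _) hx hy

lemma padicNorm_five_mul_le_one {x y : ℚ} (hx : padicNorm 5 x ≤ 1) (hy : padicNorm 5 y ≤ 1) :
    padicNorm 5 (x * y) ≤ 1 := by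
  rw [padicNorm.mul]
  exact mul_le_one₀ hx (padicNorm.nonneg _) hy

lemma padicNorm_five_add_lt_one {x y : ℚ} (hx : padicNorm 5 x < 1) (hy : padicNorm 5 y < 1) :
    padicNorm 5 (x + y) < 1 :=
  padicNorm.nonarchimedean.trans_lt (max_lt hx hy)

lemma padicNorm_five_five_lt_one : padicNorm 5 (5 : ℚ) < 1 := by
  exact_mod_cast padicNorm.padicNorm_p_lt_one_of_prime (p := 5)

lemma five_pow_mul_split {k m : ℕ} (hk : k ≤ m) (x y : ℚ) :
    5 ^ (m / 2) * (x * y) =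
      5 ^ (m / 2 - k / 2 - (m - k) / 2) * ((5 ^ (k / 2) * x) * (5 ^ ((m - k) / 2) * y)) := by
  have : m / 2 = (m / 2 - k / 2 - (m - k) / 2) + k / 2 + (m - k) / 2 := by omega
  conv_lhs => rw [this, pow_add, pow_add]
  ring

lemma padicNorm_five_pow_le_one (d : ℕ) : padicNorm 5 ((5 : ℚ) ^ d) ≤ 1 := by
  exact_mod_cast padicNorm.of_nat (p := 5) (5 ^ d)

namespace IsEpsilon

variable {ε : ℕ → ℚ}

lemma padicNorm_five_le_one (hε : IsEpsilon ε) (m : ℕ) :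
    padicNorm 5 (5 ^ (m / 2) * ε m) ≤ 1 := by
  induction m using Nat.strong_induction_on with
  | _ m ih =>
    rcases Nat.eq_zero_or_pos m with rfl | hm
    · simp [hε.1]
    · have h := hε.sum_arcsinhCoeff_mul hm.ne'
      rw [Finset.sum_range_succ', arcsinhCoeff_zero, one_mul, Nat.sub_zero] at h
      rw [eq_neg_of_add_eq_zero_right h, mul_neg, padicNorm.neg, Finset.mul_sum]
      refine padicNorm.sum_le' (fun k hk => ?_) zero_le_one
      rw [Finset.mem_range] at hk
      rw [five_pow_mul_split (k := k + 1) (by omega)]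
      exact padicNorm_five_mul_le_one (padicNorm_five_pow_le_one _)
        (padicNorm_five_mul_le_one (padicNorm_five_arcsinhCoeff_le_one _)
          (ih (m - (k + 1)) (by omega)))

lemma padicNorm_five_term_lt_one (hε : IsEpsilon ε) {k m : ℕ} (hk : 4 ≤ k) (hm : k ≤ m) :
    padicNorm 5 (5 ^ (m / 2) * (arcsinhCoeff k * ε (m - k))) < 1 := by
  rw [five_pow_mul_split hm, mul_left_comm]
  exact padicNorm_five_mul_lt_one (padicNorm_five_arcsinhCoeff_lt_one hk)
    (padicNorm_five_mul_le_one (padicNorm_five_pow_le_one _) (hε.padicNorm_five_le_one _))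

lemma padicNorm_five_term_lt_one_of_odd (hε : IsEpsilon ε) {k m : ℕ} (hk : Odd k)
    (hm : Even m) (hkm : k ≤ m) :
    padicNorm 5 (5 ^ (m / 2) * (arcsinhCoeff k * ε (m - k))) < 1 := by
  have : m / 2 - k / 2 - (m - k) / 2 = 1 := by
    obtain ⟨a, rfl⟩ := hk
    obtain ⟨b, rfl⟩ := hm
    omega
  rw [five_pow_mul_split hkm, this, pow_one]
  exact padicNorm_five_mul_lt_one padicNorm_five_five_lt_one
    (padicNorm_five_mul_le_one (padicNorm_five_arcsinhCoeff_le_one _)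
      (hε.padicNorm_five_le_one _))

lemma padicNorm_five_even_step (hε : IsEpsilon ε) (n : ℕ) :
    padicNorm 5 (5 ^ (n + 1) * ε (2 * (n + 1)) + 5 ^ n * ε (2 * n)) < 1 := by
  have h := hε.sum_arcsinhCoeff_mul (m := 2 * (n + 1)) (by omega)
  rw [show 2 * (n + 1) + 1 = 2 * n + 1 + 1 + 1 by ring, Finset.sum_range_succ',
    Finset.sum_range_succ', Finset.sum_range_succ'] at h
  have hsum : padicNorm 5 (∑ k ∈ Finset.range (2 * n), 5 ^ (2 * (n + 1) / 2) *
      (arcsinhCoeff (k + 1 + 1 + 1) * ε (2 * (n + 1) - (k + 1 + 1 + 1)))) < 1 := by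
    refine padicNorm.sum_lt' (fun k hk => ?_) one_pos
    rw [Finset.mem_range] at hk
    rcases Nat.eq_zero_or_pos k with rfl | hk'
    · exact hε.padicNorm_five_term_lt_one_of_odd (by decide) (by simp) (by omega)
    · exact hε.padicNorm_five_term_lt_one (by omega) (by omega)
  have h1 := hε.padicNorm_five_term_lt_one_of_odd (k := 1) (m := 2 * (n + 1)) (by decide)
    (by simp) (by omega)
  rw [← Finset.mul_sum] at hsum
  rw [show 2 * (n + 1) / 2 = n + 1 by omega] at hsum h1
  have h5 := padicNorm_five_mul_lt_one (x := -5 / 6) (y := 5 ^ n * ε (2 * n))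
    (by simpa using padicNorm_five_div_lt_one (a := -5) (b := 6) (by norm_num) (by norm_num))
    (by simpa using hε.padicNorm_five_le_one (2 * n))
  rw [← padicNorm.neg] at hsum h1 h5
  convert padicNorm_five_add_lt_one (padicNorm_five_add_lt_one hsum h1) h5 using 2
  have ha2 : arcsinhCoeff (0 + 1 + 1) = 1 / 30 := by
    norm_num [arcsinhCoeff, Nat.centralBinom, Nat.choose]
  rw [arcsinhCoeff_zero, ha2, show 2 * (n + 1) - (0 + 1 + 1) = 2 * n by omega,
    show 2 * (n + 1) - (0 + 1) = 2 * (n + 1) - 1 by omega, zero_add, Nat.sub_zero] at h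
  linear_combination 5 ^ n * 5 * h

lemma padicNorm_five_odd_step (hε : IsEpsilon ε) (n : ℕ) :
    padicNorm 5 (5 ^ (n + 1) * ε (2 * (n + 1) + 1) - 5 ^ (n + 1) * ε (2 * (n + 1)) +
      5 ^ n * ε (2 * n + 1) - 2 * (5 ^ n * ε (2 * n))) < 1 := by
  have h := hε.sum_arcsinhCoeff_mul (m := 2 * (n + 1) + 1) (by omega)
  rw [show 2 * (n + 1) + 1 + 1 = 2 * n + 1 + 1 + 1 + 1 by ring, Finset.sum_range_succ',
    Finset.sum_range_succ', Finset.sum_range_succ', Finset.sum_range_succ'] at h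
  have hsum : padicNorm 5 (∑ k ∈ Finset.range (2 * n), 5 ^ ((2 * (n + 1) + 1) / 2) *
      (arcsinhCoeff (k + 1 + 1 + 1 + 1) *
        ε (2 * (n + 1) + 1 - (k + 1 + 1 + 1 + 1)))) < 1 := by
    refine padicNorm.sum_lt' (fun k hk => ?_) one_pos
    rw [Finset.mem_range] at hk
    exact hε.padicNorm_five_term_lt_one (by omega) (by omega)
  rw [← Finset.mul_sum, show (2 * (n + 1) + 1) / 2 = n + 1 by omega, ← padicNorm.neg] at hsum
  have h1 := padicNorm_five_mul_lt_one (x := -5 / 6) (y := 5 ^ (n + 1) * ε (2 * (n + 1)))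
    (by simpa using padicNorm_five_div_lt_one (a := -5) (b := 6) (by norm_num) (by norm_num))
    (by simpa using hε.padicNorm_five_le_one (2 * (n + 1)))
  have h2 := padicNorm_five_mul_lt_one (x := 5 / 6) (y := 5 ^ n * ε (2 * n + 1))
    (by simpa using padicNorm_five_div_lt_one (a := 5) (b := 6) (by norm_num) (by norm_num))
    (by simpa [show (2 * n + 1) / 2 = n by omega] using hε.padicNorm_five_le_one (2 * n + 1))
  have h3 := padicNorm_five_mul_lt_one (x := -55 / 28) (y := 5 ^ n * ε (2 * n))
    (by simpa using padicNorm_five_div_lt_one (a := -55) (b := 28) (by norm_num) (by norm_num))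
    (by simpa using hε.padicNorm_five_le_one (2 * n))
  convert padicNorm_five_add_lt_one (padicNorm_five_add_lt_one
    (padicNorm_five_add_lt_one hsum h1) h2) h3 using 2
  have ha1 : arcsinhCoeff (0 + 1) = -1 / 6 := by
    norm_num [arcsinhCoeff, Nat.centralBinom]
  have ha2 : arcsinhCoeff (0 + 1 + 1) = 1 / 30 := by
    norm_num [arcsinhCoeff, Nat.centralBinom, Nat.choose]
  have ha3 : arcsinhCoeff (0 + 1 + 1 + 1) = -1 / 140 := by
    norm_num [arcsinhCoeff, Nat.centralBinom, Nat.choose]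
  rw [arcsinhCoeff_zero, ha1, ha2, ha3,
    show 2 * (n + 1) + 1 - (0 + 1 + 1 + 1) = 2 * n by omega,
    show 2 * (n + 1) + 1 - (0 + 1 + 1) = 2 * n + 1 by omega,
    show 2 * (n + 1) + 1 - (0 + 1) = 2 * (n + 1) by omega, Nat.sub_zero] at h
  linear_combination 5 ^ n * 5 * h

lemma padicNorm_five_congruence (hε : IsEpsilon ε) (n : ℕ) :
    padicNorm 5 (5 ^ n * ε (2 * n) - (-1) ^ n) < 1 ∧
      padicNorm 5 (5 ^ n * ε (2 * n + 1) - (-1) ^ n * (1 - n)) < 1 := by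
  induction n with
  | zero =>
    refine ⟨by simp [hε.1], ?_⟩
    have h := hε.sum_arcsinhCoeff_mul (m := 1) one_ne_zero
    have ha1 : arcsinhCoeff 1 = -1 / 6 := by norm_num [arcsinhCoeff, Nat.centralBinom]
    simp only [Finset.sum_range_succ, Finset.range_zero, Finset.sum_empty, arcsinhCoeff_zero, ha1,
      hε.1, Nat.sub_self, Nat.sub_zero] at h
    have : (5 : ℚ) ^ 0 * ε (2 * 0 + 1) - (-1) ^ 0 * (1 - (0 : ℕ)) = (-5 : ℤ) / (6 : ℤ) := by
      push_cast
      linear_combination h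
    rw [this]
    exact padicNorm_five_div_lt_one (by norm_num) (by norm_num)
  | succ n ih =>
    obtain ⟨h0, h1⟩ := ih
    have h0' := h0
    rw [← padicNorm.neg] at h0' h1
    have heven : padicNorm 5 (5 ^ (n + 1) * ε (2 * (n + 1)) - (-1) ^ (n + 1)) < 1 := by
      convert padicNorm_five_add_lt_one (hε.padicNorm_five_even_step n) h0' using 2
      ring
    have h2 : padicNorm 5 ((5 ^ n * ε (2 * n) - (-1) ^ n) * 2) < 1 :=
      padicNorm_five_mul_lt_one h0 (by exact_mod_cast padicNorm.of_nat (p := 5) 2)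
    refine ⟨heven, ?_⟩
    convert padicNorm_five_add_lt_one (padicNorm_five_add_lt_one (padicNorm_five_add_lt_one
      (hε.padicNorm_five_odd_step n) heven) h1) h2 using 2
    push_cast
    ring

end IsEpsilon

lemma padicNorm_five_main_term (m : ℕ) :
    padicNorm 5 ((-1) ^ (m + 1) * (1 - ((m + 1 : ℕ) : ℚ)) -
      5 ^ (m + 1) * ((-1 : ℚ) ^ (m + 1) * (2 ^ (2 * (m + 1)) * ((7 : ℚ) - 2 * (m + 1 : ℕ)) /
        ((Nat.factorial 5 : ℚ) ^ m * (Nat.factorial 7 : ℚ))))) < 1 := by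
  obtain ⟨c, hc⟩ : (5 : ℤ) ∣ 24 ^ m - 4 ^ m :=
    (by norm_num : (5 : ℤ) ∣ 24 - 4).trans (sub_dvd_pow_sub_pow _ _ m)
  have h24 : ¬ (5 : ℤ) ∣ 24 ^ m * 1008 := by
    intro h
    rcases Int.Prime.dvd_mul' Nat.prime_five h with h | h
    · have := Int.Prime.dvd_pow' Nat.prime_five h
      norm_num at this
    · norm_num at h
  have hfrac : (-1) ^ (m + 1) * (1 - ((m + 1 : ℕ) : ℚ)) -
      5 ^ (m + 1) * ((-1 : ℚ) ^ (m + 1) * (2 ^ (2 * (m + 1)) * ((7 : ℚ) - 2 * (m + 1 : ℕ)) /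
        ((Nat.factorial 5 : ℚ) ^ m * (Nat.factorial 7 : ℚ)))) =
      (((-1) ^ m * (5 * (4 ^ m * (4 + 200 * m) + 1008 * m * c)) : ℤ) : ℚ) /
        ((24 ^ m * 1008 : ℤ) : ℚ) := by
    have hc' : (24 : ℚ) ^ m - 4 ^ m = 5 * c := by exact_mod_cast hc
    have h5 : (Nat.factorial 5 : ℚ) ^ m = 5 ^ m * 24 ^ m := by
      rw [← mul_pow]; norm_num [Nat.factorial]
    have h7 : (Nat.factorial 7 : ℚ) = 5 * 1008 := by norm_num [Nat.factorial]
    rw [h5, h7, pow_mul]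
    push_cast
    rw [pow_succ, pow_succ, pow_succ, show (2 : ℚ) ^ 2 = 4 by norm_num]
    field_simp
    linear_combination (1008 * (m : ℚ)) * hc'
  rw [hfrac]
  exact padicNorm_five_div_lt_one ((dvd_mul_right _ _).mul_left _) h24


theorem epsilon_odd_index_congruence_five (ε : ℕ → ℚ) (hε : IsEpsilon ε) (n : ℕ)
    (hn : 1 ≤ n) :
    ε (2 * n + 1) -
        (-1 : ℚ) ^ n * (2 ^ (2 * n) * ((7 : ℚ) - 2 * n) /
          (((Nat.factorial 5 : ℚ)) ^ (n - 1) * ((Nat.factorial 7 : ℚ)))) = 0 ∨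
      -(n : ℤ) + 1 ≤
        padicValRat 5
          (ε (2 * n + 1) -
            (-1 : ℚ) ^ n * (2 ^ (2 * n) * ((7 : ℚ) - 2 * n) /
              (((Nat.factorial 5 : ℚ)) ^ (n - 1) * ((Nat.factorial 7 : ℚ))))) := by
  obtain ⟨m, rfl⟩ : ∃ m, n = m + 1 := ⟨n - 1, by omega⟩
  have h := padicNorm_five_add_lt_one (hε.padicNorm_five_congruence (m + 1)).2
    (padicNorm_five_main_term m)
  rw [sub_add_sub_cancel, ← mul_sub] at h
  rw [Nat.add_sub_cancel]
  refine or_iff_not_imp_left.mpr fun hne => ?_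
  rw [padicNorm_lt_one_iff (mul_ne_zero (by positivity) hne),
    padicValRat.mul (by positivity) hne, padicValRat_five_pow] at h
  push_cast at h ⊢
  linarith
end
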